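/- arXiv:1512.00365 — 2 statements merged into one kernel-verified Lean document; each statement's English description precedes it below -/
import Mathlib

section
/- For all positive integers a and b, the order of K-promotion ∂ on Inc^{a+b+1}(a×b) is exactly a + b + 1; that is, the least m > 0 with ∂^m equal to the identity on Inc^{a+b+1}(a×b) is a + b + 1. -/
open scoped Classical

/-- Two cells of `ℕ × ℕ` are horizontally or vertically adjacent. -/
def incAdj (c d : ℕ × ℕ) : Prop :=
  (c.1 = d.1 ∧ (c.2 + 1 = d.2 ∨ d.2 + 1 = c.2)) ∨
  (c.2 = d.2 ∧ (c.1 + 1 = d.1 ∨ d.1 + 1 = c.1))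

/-- `T` is an increasing tableau on the cell set `μ` with entries in `{1,…,q}`:
entries strictly increase along rows and down columns. -/
def IsIncTab (μ : Finset (ℕ × ℕ)) (q : ℕ) (T : ℕ × ℕ → ℕ) : Prop :=
  (∀ c ∈ μ, 1 ≤ T c ∧ T c ≤ q) ∧
  (∀ c ∈ μ, ∀ d ∈ μ, c.1 = d.1 → c.2 < d.2 → T c < T d) ∧
  (∀ c ∈ μ, ∀ d ∈ μ, c.2 = d.2 → c.1 < d.1 → T c < T d)

/-- The `i`-th K-Bender-Knuth involution: every entry `i` with no adjacent cell
containing `i+1` becomes `i+1`, and every entry `i+1` with no adjacent cell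
containing `i` becomes `i`. -/
noncomputable def kbkMap (μ : Finset (ℕ × ℕ)) (i : ℕ) (T : ℕ × ℕ → ℕ) : ℕ × ℕ → ℕ :=
  fun c =>
    if c ∈ μ ∧ T c = i ∧ ¬ ∃ d ∈ μ, incAdj c d ∧ T d = i + 1 then i + 1
    else if c ∈ μ ∧ T c = i + 1 ∧ ¬ ∃ d ∈ μ, incAdj c d ∧ T d = i then i
    else T c

/-- K-promotion `∂ = kbk_{q-1} ∘ ⋯ ∘ kbk_1` (with `kbk_1` applied first). -/
noncomputable def kPromo (μ : Finset (ℕ × ℕ)) (q : ℕ) (T : ℕ × ℕ → ℕ) : ℕ × ℕ → ℕ :=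
  (List.range (q - 1)).foldl (fun S k => kbkMap μ (k + 1) S) T

/-- The cells of the rectangular shape `a × b` (rows `0,…,a-1`, columns `0,…,b-1`). -/
def rectCells (a b : ℕ) : Finset (ℕ × ℕ) := Finset.range a ×ˢ Finset.range b

/-- Increasing tableaux of rectangular shape `a × b` with entries at most `q`,
represented canonically as functions `ℕ × ℕ → ℕ` vanishing off the rectangle. -/
def IncTabSet (a b q : ℕ) : Set (ℕ × ℕ → ℕ) :=
  {T | IsIncTab (rectCells a b) q T ∧ ∀ p : ℕ × ℕ, p ∉ rectCells a b → T p = 0}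

/-! ### Part 1: a characterization of K-promotion -/

lemma kbk_step (μ : Finset (ℕ × ℕ)) (q : ℕ) (T T' : ℕ × ℕ → ℕ)
    (hoff : ∀ c, c ∉ μ → T' c = T c)
    (P0 : ∀ c ∈ μ, T c ≤ T' c + 1)
    (P1 : ∀ c ∈ μ, ∀ d ∈ μ, incAdj c d → T c < T d → T' c < T d)
    (P2 : ∀ c ∈ μ, T c ≤ T' c → T' c = q ∨ ∃ d ∈ μ, incAdj c d ∧ T d = T' c + 1)
    (P3 : ∀ c ∈ μ, T c ≤ T' c → 2 ≤ T c → ∃ d ∈ μ, incAdj c d ∧ T' d + 1 = T c)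
    (P4 : ∀ c ∈ μ, ∀ d ∈ μ, incAdj c d → T c ≠ T d)
    (P5 : ∀ c ∈ μ, ∀ d ∈ μ, incAdj c d → T d < T c → T' d < T' c)
    (i : ℕ) (hi : i + 1 < q) :
    kbkMap μ (i + 1) (fun c => if c ∈ μ then (if T' c ≤ i then T' c else max (T c) (i + 1)) else T c)
      = (fun c => if c ∈ μ then (if T' c ≤ i + 1 then T' c else max (T c) (i + 1 + 1)) else T c) := by
  set S : ℕ × ℕ → ℕ :=
    (fun c => if c ∈ μ then (if T' c ≤ i then T' c else max (T c) (i + 1)) else T c) with hS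
  have S1 : ∀ c ∈ μ, (S c = i + 1 ↔ i < T' c ∧ T c ≤ i + 1) := by
    intro c hc
    simp only [hS, if_pos hc]
    split_ifs <;> omega
  have S2 : ∀ c ∈ μ, (S c = i + 1 + 1 ↔ T c = i + 2) := by
    intro c hc
    have := P0 c hc
    simp only [hS, if_pos hc]
    split_ifs <;> omega
  funext c
  by_cases hc : c ∈ μ
  swap
  · simp [kbkMap, hc, hS]
  have p0 := P0 c hc
  have E1 : i < T' c → T c ≤ i + 1 → ((∃ d ∈ μ, incAdj c d ∧ S d = i + 1 + 1) ↔ T' c = i + 1) := by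
    intro h1 h2
    constructor
    · rintro ⟨d, hd, had, hSd⟩
      rw [S2 d hd] at hSd
      have := P1 c hc d hd had (by omega)
      omega
    · intro h
      rcases P2 c hc (by omega) with h' | ⟨d, hd, had, hd'⟩
      · omega
      · exact ⟨d, hd, had, (S2 d hd).2 (by omega)⟩
  have E2 : T c = i + 2 → ((∃ d ∈ μ, incAdj c d ∧ S d = i + 1) ↔ i + 2 ≤ T' c) := by
    intro h
    constructor
    · rintro ⟨d, hd, had, hSd⟩
      rw [S1 d hd] at hSd
      have := P5 c hc d hd had (by omega)
      omega
    · intro h'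
      obtain ⟨d, hd, had, hd'⟩ := P3 c hc (by omega) (by omega)
      refine ⟨d, hd, had, (S1 d hd).2 ?_⟩
      have := P4 c hc d hd had
      have := P0 d hd
      omega
  have hSc : S c = if T' c ≤ i then T' c else max (T c) (i + 1) := by simp [hS, hc]
  unfold kbkMap
  simp only [hc, true_and, if_true]
  have s1 := S1 c hc
  have s2 := S2 c hc
  clear S1 S2 P0 P1 P2 P3 P4 P5 hS hoff
  by_cases hX : (∃ d ∈ μ, incAdj c d ∧ S d = i + 1 + 1) <;>
  by_cases hY : (∃ d ∈ μ, incAdj c d ∧ S d = i + 1) <;>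
  simp only [hX, hY, true_iff, false_iff, not_true, not_false_iff, and_true, and_false, if_false]
    at E1 E2 ⊢ <;>
  clear hX hY <;> generalize S c = s at * <;> clear S <;> split_ifs at * <;> omega

lemma kPromo_char (μ : Finset (ℕ × ℕ)) (q : ℕ) (hq : 1 ≤ q) (T T' : ℕ × ℕ → ℕ)
    (hoff : ∀ c, c ∉ μ → T' c = T c)
    (B0 : ∀ c ∈ μ, 1 ≤ T c) (B1 : ∀ c ∈ μ, 1 ≤ T' c) (B2 : ∀ c ∈ μ, T' c ≤ q)
    (B3 : ∀ c ∈ μ, T c ≤ q)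
    (P0 : ∀ c ∈ μ, T c ≤ T' c + 1)
    (P1 : ∀ c ∈ μ, ∀ d ∈ μ, incAdj c d → T c < T d → T' c < T d)
    (P2 : ∀ c ∈ μ, T c ≤ T' c → T' c = q ∨ ∃ d ∈ μ, incAdj c d ∧ T d = T' c + 1)
    (P3 : ∀ c ∈ μ, T c ≤ T' c → 2 ≤ T c → ∃ d ∈ μ, incAdj c d ∧ T' d + 1 = T c)
    (P4 : ∀ c ∈ μ, ∀ d ∈ μ, incAdj c d → T c ≠ T d)
    (P5 : ∀ c ∈ μ, ∀ d ∈ μ, incAdj c d → T d < T c → T' d < T' c) :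
    kPromo μ q T = T' := by
  have key : ∀ i, i < q → (List.range i).foldl (fun S k => kbkMap μ (k + 1) S) T =
      (fun c => if c ∈ μ then (if T' c ≤ i then T' c else max (T c) (i + 1)) else T c) := by
    intro i
    induction i with
    | zero =>
      intro _
      funext c
      by_cases hc : c ∈ μ
      · have := B0 c hc
        have := B1 c hc
        simp only [List.range_zero, List.foldl_nil, hc, if_true]
        split_ifs <;> omega
      · simp [hc]
    | succ i ih =>
      intro h
      rw [List.range_succ, List.foldl_append, ih (by omega)]
      simp only [List.foldl_cons, List.foldl_nil]
      exact kbk_step μ q T T' hoff P0 P1 P2 P3 P4 P5 i h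
  unfold kPromo
  rw [key (q - 1) (by omega)]
  funext c
  by_cases hc : c ∈ μ
  · have := B2 c hc
    have := B3 c hc
    simp only [hc, if_true]
    split_ifs <;> omega
  · simp [hc, hoff c hc]

/-! ### Part 2: row lengths -/

/-- Valid pairs of row-length sequences (rows `1,…,a`, with the conventions that
row `0` has length `b` and the rows after row `a` have length `0`). -/
structure RLVal (a b : ℕ) (l1 l2 : ℕ → ℕ) : Prop where
  z1 : l1 0 = b
  z2 : l2 0 = b
  m1 : ∀ x, l1 (x + 1) ≤ l1 x
  m2 : ∀ x, l2 (x + 1) ≤ l2 x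
  le : ∀ x, l1 x ≤ l2 x
  e1 : ∀ x, a < x → l1 x = 0
  e2 : ∀ x, a < x → l2 x = 0

/-- Promotion on the first row-length sequence. -/
def nxA (a b : ℕ) (l1 l2 : ℕ → ℕ) : ℕ → ℕ
  | 0 => b
  | x + 1 => if a < x + 1 then 0 else
      if l1 (x + 1 + 1) < l1 (x + 1) then l1 (x + 1) - 1 else min (nxA a b l1 l2 x) (l2 (x + 1))

/-- Promotion on the second row-length sequence. -/
def nxB (a b : ℕ) (l1 l2 : ℕ → ℕ) : ℕ → ℕ
  | 0 => b
  | x + 1 => if a < x + 1 then 0 else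
      if l2 (x + 1 + 1) < l2 (x + 1) ∧ nxA a b l1 l2 (x + 1) < l2 (x + 1) then l2 (x + 1) - 1
      else nxB a b l1 l2 x

lemma nxA_succ (a b : ℕ) (l1 l2 : ℕ → ℕ) (x : ℕ) (hx : x < a) :
    (l1 (x + 1 + 1) < l1 (x + 1) ∧ nxA a b l1 l2 (x + 1) + 1 = l1 (x + 1)) ∨
    (l1 (x + 1) ≤ l1 (x + 1 + 1) ∧ nxA a b l1 l2 (x + 1) = min (nxA a b l1 l2 x) (l2 (x + 1))) := by
  rw [nxA]
  split_ifs <;> omega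

lemma nxB_succ (a b : ℕ) (l1 l2 : ℕ → ℕ) (x : ℕ) (hx : x < a) :
    (l2 (x + 1 + 1) < l2 (x + 1) ∧ nxA a b l1 l2 (x + 1) < l2 (x + 1) ∧
      nxB a b l1 l2 (x + 1) + 1 = l2 (x + 1)) ∨
    ((l2 (x + 1) ≤ l2 (x + 1 + 1) ∨ l2 (x + 1) ≤ nxA a b l1 l2 (x + 1)) ∧
      nxB a b l1 l2 (x + 1) = nxB a b l1 l2 x) := by
  rw [nxB]
  split_ifs <;> omega

lemma nxA_out (a b : ℕ) (l1 l2 : ℕ → ℕ) (x : ℕ) (hx : a < x) : nxA a b l1 l2 x = 0 := by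
  cases x with
  | zero => omega
  | succ x => rw [nxA]; simp; omega

lemma nxB_out (a b : ℕ) (l1 l2 : ℕ → ℕ) (x : ℕ) (hx : a < x) : nxB a b l1 l2 x = 0 := by
  cases x with
  | zero => omega
  | succ x => rw [nxB]; simp; omega

lemma nx_facts {a b : ℕ} {l1 l2 : ℕ → ℕ} (h : RLVal a b l1 l2) (x : ℕ) :
    l1 (x + 1) ≤ nxA a b l1 l2 x ∧ l2 (x + 1) ≤ nxB a b l1 l2 x ∧
    nxA a b l1 l2 x ≤ l2 x ∧ nxA a b l1 l2 x ≤ nxB a b l1 l2 x := by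
  induction x with
  | zero =>
    have := h.z1; have := h.z2; have := h.m1 0; have := h.m2 0
    simp only [nxA, nxB]; omega
  | succ x ih =>
    have := h.m1 (x + 1); have := h.m2 (x + 1)
    have := h.le (x + 1)
    have := h.le (x + 1 + 1)
    by_cases hx : x < a
    · have := nxA_succ a b l1 l2 x hx
      have := nxB_succ a b l1 l2 x hx
      omega
    · have := nxA_out a b l1 l2 (x + 1) (by omega)
      have := nxB_out a b l1 l2 (x + 1) (by omega)
      have := h.e1 (x + 1) (by omega)
      have := h.e2 (x + 1) (by omega)
      have := h.e1 (x + 1 + 1) (by omega)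
      have := h.e2 (x + 1 + 1) (by omega)
      omega

lemma nx_val {a b : ℕ} {l1 l2 : ℕ → ℕ} (h : RLVal a b l1 l2) :
    RLVal a b (nxA a b l1 l2) (nxB a b l1 l2) where
  z1 := by simp [nxA]
  z2 := by simp [nxB]
  m1 := by
    intro x
    have := nx_facts h x
    by_cases hx : x < a
    · have := nxA_succ a b l1 l2 x hx; omega
    · have := nxA_out a b l1 l2 (x + 1) (by omega); omega
  m2 := by
    intro x
    have := nx_facts h x
    by_cases hx : x < a
    · have := nxB_succ a b l1 l2 x hx; omega
    · have := nxB_out a b l1 l2 (x + 1) (by omega); omega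
  le := fun x => (nx_facts h x).2.2.2
  e1 := nxA_out a b l1 l2
  e2 := nxB_out a b l1 l2

lemma RLVal.leb {a b : ℕ} {l1 l2 : ℕ → ℕ} (h : RLVal a b l1 l2) (x : ℕ) : l2 x ≤ b := by
  induction x with
  | zero => exact h.z2.le
  | succ x ih => exact (h.m2 x).trans ih

/-- The tableau with given row lengths. -/
def rlTab (l1 l2 : ℕ → ℕ) (x y : ℕ) : ℕ :=
  x + y + 1 + (if y < l1 (x + 1) then 0 else 1) + (if y < l2 (x + 1) then 0 else 1)

lemma rlTab_spec (l1 l2 : ℕ → ℕ) (x y : ℕ) :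
    (y < l1 (x + 1) ∧ y < l2 (x + 1) ∧ rlTab l1 l2 x y = x + y + 1) ∨
    (y < l1 (x + 1) ∧ l2 (x + 1) ≤ y ∧ rlTab l1 l2 x y = x + y + 2) ∨
    (l1 (x + 1) ≤ y ∧ y < l2 (x + 1) ∧ rlTab l1 l2 x y = x + y + 2) ∨
    (l1 (x + 1) ≤ y ∧ l2 (x + 1) ≤ y ∧ rlTab l1 l2 x y = x + y + 3) := by
  unfold rlTab
  split_ifs <;> omega

lemma adj_cases {a b : ℕ} {R : ℕ × ℕ → ℕ × ℕ → Prop}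
    (hr : ∀ x y, x < a → y + 1 < b → R (x, y) (x, y + 1) ∧ R (x, y + 1) (x, y))
    (hd : ∀ x y, x + 1 < a → y < b → R (x, y) (x + 1, y) ∧ R (x + 1, y) (x, y)) :
    ∀ c ∈ rectCells a b, ∀ d ∈ rectCells a b, incAdj c d → R c d := by
  rintro ⟨x, y⟩ hc ⟨x', y'⟩ hd' hadj
  simp only [rectCells, Finset.mem_product, Finset.mem_range] at hc hd'
  simp only [incAdj] at hadj
  rcases hadj with ⟨rfl, rfl | rfl⟩ | ⟨rfl, rfl | rfl⟩
  · exact (hr _ _ hc.1 hd'.2).1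
  · exact (hr _ _ hc.1 hc.2).2
  · exact (hd _ _ hd'.1 hc.2).1
  · exact (hd _ _ hc.1 hc.2).2

set_option maxHeartbeats 2000000 in
lemma promo_rl {a b : ℕ} {l1 l2 : ℕ → ℕ} (h : RLVal a b l1 l2) (T : ℕ × ℕ → ℕ)
    (hT : ∀ x y, x < a → y < b → T (x, y) = rlTab l1 l2 x y) :
    kPromo (rectCells a b) (a + b + 1) T = fun c => if c ∈ rectCells a b then
      rlTab (nxA a b l1 l2) (nxB a b l1 l2) c.1 c.2 else T c := by
  have h' := nx_val h
  have FA := nxA_succ a b l1 l2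
  have FB := nxB_succ a b l1 l2
  have FF := fun x => nx_facts h x
  generalize nxA a b l1 l2 = k1 at *
  generalize nxB a b l1 l2 = k2 at *
  have hmem : ∀ x y, x < a → y < b → (x, y) ∈ rectCells a b := by
    intro x y hx hy
    simp [rectCells, hx, hy]
  have hall : ∀ {R : ℕ × ℕ → Prop}, (∀ x y, x < a → y < b → R (x, y)) →
      ∀ c ∈ rectCells a b, R c := by
    rintro R hR ⟨x, y⟩ hc
    simp only [rectCells, Finset.mem_product, Finset.mem_range] at hc
    exact hR x y hc.1 hc.2
  set T' : ℕ × ℕ → ℕ := fun c => if c ∈ rectCells a b then rlTab k1 k2 c.1 c.2 else T c with hT'0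
  have hT' : ∀ x y, x < a → y < b → T' (x, y) = rlTab k1 k2 x y := by
    intro x y hx hy
    simp [hT'0, hmem x y hx hy]
  apply kPromo_char
  · omega
  · intro c hc; simp [hT'0, hc]
  · apply hall; intro x y hx hy
    rw [hT x y hx hy]
    have := rlTab_spec l1 l2 x y; omega
  · apply hall; intro x y hx hy
    rw [hT' x y hx hy]
    have := rlTab_spec k1 k2 x y; omega
  · apply hall; intro x y hx hy
    rw [hT' x y hx hy]
    have := rlTab_spec k1 k2 x y; omega
  · apply hall; intro x y hx hy
    rw [hT x y hx hy]
    have := rlTab_spec l1 l2 x y; omega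
  · -- P0
    apply hall; intro x y hx hy
    rw [hT x y hx hy, hT' x y hx hy]
    have := rlTab_spec k1 k2 x y
    have := rlTab_spec l1 l2 x y
    have := FA x hx
    have := FB x hx
    have := FF x
    have := FF (x + 1)
    have := h.le (x + 1)
    omega
  · -- P1
    apply adj_cases (R := fun c d => T c < T d → T' c < T d)
    · intro x y hx hy
      rw [hT x y hx (by omega), hT' x y hx (by omega), hT x (y + 1) hx (by omega),
        hT' x (y + 1) hx (by omega)]
      have := rlTab_spec k1 k2 x y
      have := rlTab_spec l1 l2 x y
      have := rlTab_spec k1 k2 x (y + 1)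
      have := rlTab_spec l1 l2 x (y + 1)
      have := FA x hx
      have := FB x hx
      have := FF x
      have := FF (x + 1)
      have := h.le (x + 1)
      omega
    · intro x y hx hy
      rw [hT x y (by omega) (by omega), hT' x y (by omega) (by omega),
        hT (x + 1) y (by omega) (by omega), hT' (x + 1) y (by omega) (by omega)]
      have := rlTab_spec k1 k2 x y
      have := rlTab_spec l1 l2 x y
      have := rlTab_spec k1 k2 (x + 1) y
      have := rlTab_spec l1 l2 (x + 1) y
      have := FF (x + 1)
      have := h.m1 (x + 1)
      have := h.m2 (x + 1)
      have := h.le (x + 1)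
      have := h.le (x + 1 + 1)
      omega
  · -- P2
    apply hall; intro x y hx hy hle
    rw [hT x y hx hy, hT' x y hx hy] at hle
    rw [hT' x y hx hy]
    have := rlTab_spec k1 k2 x y
    have := rlTab_spec l1 l2 x y
    have := FA x hx
    have := FB x hx
    have := FF x
    have := FF (x + 1)
    have := h.le (x + 1)
    have := h.m1 (x + 1)
    have := h.m2 (x + 1)
    have := h'.le (x + 1)
    have := h.le (x + 1 + 1)
    have := h.leb (x + 1)
    have := h'.leb (x + 1)
    have e1 := h.e1 (x + 1 + 1)
    have e2 := h.e2 (x + 1 + 1)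
    by_cases A : y + 1 < b ∧ rlTab l1 l2 x (y + 1) = rlTab k1 k2 x y + 1
    · exact Or.inr ⟨(x, y + 1), hmem _ _ hx A.1, by simp [incAdj], by rw [hT x (y + 1) hx A.1, A.2]⟩
    by_cases B : x + 1 < a ∧ rlTab l1 l2 (x + 1) y = rlTab k1 k2 x y + 1
    · exact Or.inr ⟨(x + 1, y), hmem _ _ B.1 hy, by simp [incAdj], by rw [hT (x + 1) y B.1 hy, B.2]⟩
    left
    have := rlTab_spec l1 l2 x (y + 1)
    have := rlTab_spec l1 l2 (x + 1) y
    omega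
  · -- P3
    apply hall; intro x y hx hy hle h2
    rw [hT x y hx hy, hT' x y hx hy] at hle
    rw [hT x y hx hy] at h2
    rw [hT x y hx hy]
    have := rlTab_spec k1 k2 x y
    have := rlTab_spec l1 l2 x y
    have := FA x hx
    have := FB x hx
    have := FF x
    have := FF (x + 1)
    have := h.le (x + 1)
    have := h.m1 (x + 1)
    have := h.m2 (x + 1)
    have := h'.le (x + 1)
    have := h'.le x
    have z1 : x = 0 → k1 x = b := fun h0 => by rw [h0]; exact h'.z1
    have z2 : x = 0 → k2 x = b := fun h0 => by rw [h0]; exact h'.z2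
    by_cases A : 1 ≤ y ∧ rlTab k1 k2 x (y - 1) + 1 = rlTab l1 l2 x y
    · refine ⟨(x, y - 1), hmem _ _ hx (by omega), ?_, by rw [hT' x (y - 1) hx (by omega), A.2]⟩
      exact Or.inl ⟨rfl, Or.inr (Nat.sub_add_cancel A.1)⟩
    by_cases B : 1 ≤ x ∧ rlTab k1 k2 (x - 1) y + 1 = rlTab l1 l2 x y
    · refine ⟨(x - 1, y), hmem _ _ (by omega) hy, ?_, by rw [hT' (x - 1) y (by omega) hy, B.2]⟩
      exact Or.inr ⟨rfl, Or.inr (Nat.sub_add_cancel B.1)⟩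
    exfalso
    have r1 := rlTab_spec k1 k2 x (y - 1)
    have r2 := rlTab_spec k1 k2 (x - 1) y
    have r3 : (1 ≤ x ∧ x - 1 + 1 = x) ∨ x = 0 := by omega
    rcases r3 with ⟨r3, r4⟩ | r3
    · rw [r4] at r2
      clear z1 z2 hT hT' hT'0 hmem
      rcases FA x hx with h1 | h1 <;> rcases FB x hx with h3 | h3 <;>
      rcases rlTab_spec k1 k2 x y with h4 | h4 | h4 | h4 <;>
      rcases rlTab_spec l1 l2 x y with h5 | h5 | h5 | h5 <;> omega
    · have z1 := z1 r3
      have z2 := z2 r3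
      clear r2 B hT hT' hT'0 hmem
      rcases FA x hx with h1 | h1 <;> rcases FB x hx with h3 | h3 <;>
      rcases rlTab_spec k1 k2 x y with h4 | h4 | h4 | h4 <;>
      rcases rlTab_spec l1 l2 x y with h5 | h5 | h5 | h5 <;> omega
  · -- P4
    apply adj_cases (R := fun c d => T c ≠ T d)
    · intro x y hx hy
      rw [hT x y hx (by omega), hT x (y + 1) hx (by omega)]
      have := rlTab_spec l1 l2 x y
      have := rlTab_spec l1 l2 x (y + 1)
      omega
    · intro x y hx hy
      rw [hT x y (by omega) (by omega), hT (x + 1) y (by omega) (by omega)]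
      have := rlTab_spec l1 l2 x y
      have := rlTab_spec l1 l2 (x + 1) y
      have := h.m1 (x + 1)
      have := h.m2 (x + 1)
      omega
  · -- P5
    apply adj_cases (R := fun c d => T d < T c → T' d < T' c)
    · intro x y hx hy
      rw [hT x y hx (by omega), hT' x y hx (by omega), hT x (y + 1) hx (by omega),
        hT' x (y + 1) hx (by omega)]
      have := rlTab_spec k1 k2 x y
      have := rlTab_spec l1 l2 x y
      have := rlTab_spec k1 k2 x (y + 1)
      have := rlTab_spec l1 l2 x (y + 1)
      omega
    · intro x y hx hy
      rw [hT x y (by omega) (by omega), hT' x y (by omega) (by omega),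
        hT (x + 1) y (by omega) (by omega), hT' (x + 1) y (by omega) (by omega)]
      have := rlTab_spec k1 k2 x y
      have := rlTab_spec l1 l2 x y
      have := rlTab_spec k1 k2 (x + 1) y
      have := rlTab_spec l1 l2 (x + 1) y
      have := h.m1 (x + 1)
      have := h.m2 (x + 1)
      have := h'.m1 (x + 1)
      have := h'.m2 (x + 1)
      omega

/-! ### Part 3: rotation of noncrossing partitions, encoded by height functions -/

/-- Height functions of a noncrossing partition of `{0,…,q-1}`. -/
structure Hts (q : ℕ) (G H : ℕ → ℤ) : Prop where
  g0 : G 0 = 0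
  gn : ∀ i, i < q → 0 ≤ G i
  gh : ∀ i, i < q → G i ≤ H i ∧ H i ≤ G i + 1
  hg : ∀ i, i + 1 < q → G (i + 1) ≤ H i ∧ H i ≤ G (i + 1) + 1
  he : H (q - 1) = 0

/-- `i < j` are in the same block. -/
def Blk (G H : ℕ → ℤ) (i j : ℕ) : Prop :=
  G j = G i ∧ ∀ k, i ≤ k → k < j → G i < H k

/-- One step of promotion on height functions. -/
structure HStep (q : ℕ) (G H G' H' : ℕ → ℤ) (e m : ℕ) : Prop where
  elt : e < q
  He : H e = 0
  Hp : ∀ k, k < e → 0 < H k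
  m0 : e = 0 → m = q
  m1 : 0 < e → 1 ≤ m ∧ m ≤ e ∧ G m = 0
  Gp : 0 < e → ∀ k, 1 ≤ k → k < m → 0 < G k
  sG : ∀ k, k + 1 < q → G' k = G (k + 1) + (if m ≤ k + 1 then 1 else 0) - (if k < e then 1 else 0)
  sH : ∀ k, k + 1 < q → H' k = H (k + 1) + (if m ≤ k + 1 then 1 else 0) -
    (if k + 1 < e then 1 else 0)
  sL : G' (q - 1) = 0

lemma rotA {q : ℕ} {G H G' H' : ℕ → ℤ} {e m : ℕ} (h : Hts q G H)
    (s : HStep q G H G' H' e m) (i j : ℕ) (hij : i < j) (hj : j + 1 < q) :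
    Blk G' H' i j ↔ Blk G H (i + 1) (j + 1) := by
  have gi := s.sG i (by omega)
  have gj := s.sG j (by omega)
  have gi0 := h.gn (i + 1) (by omega)
  have gj0 := h.gn (j + 1) (by omega)
  have elt := s.elt
  rcases Nat.eq_zero_or_pos e with he | he
  · -- no change of heights
    have hm := s.m0 he
    have hH : ∀ k, k < j → H' k = H (k + 1) := by
      intro k hk
      rw [s.sH k (by omega), if_neg (by omega), if_neg (by omega)]; ring
    rw [if_neg (by omega), if_neg (by omega)] at gi gj
    constructor
    · rintro ⟨h1, h2⟩
      refine ⟨by omega, fun k hk1 hk2 => ?_⟩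
      have := h2 (k - 1) (by omega) (by omega)
      rw [hH (k - 1) (by omega), Nat.sub_add_cancel (by omega)] at this
      omega
    · rintro ⟨h1, h2⟩
      refine ⟨by omega, fun k hk1 hk2 => ?_⟩
      have := h2 (k + 1) (by omega) (by omega)
      rw [hH k (by omega)]
      omega
  obtain ⟨hm1, hme, hGm⟩ := s.m1 he
  by_cases c1 : i < e ∧ e ≤ j
  · -- `i` before the end of the block of `0`, `j` after
    constructor
    · rintro ⟨h1, h2⟩
      exfalso
      have := h2 (e - 1) (by omega) (by omega)
      rw [s.sH (e - 1) (by omega), Nat.sub_add_cancel (by omega), s.He, if_pos (by omega),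
        if_neg (by omega)] at this
      rw [if_pos (by omega), if_neg (by omega)] at gj
      omega
    · rintro ⟨h1, h2⟩
      exfalso
      have := h2 e (by omega) (by omega)
      rw [s.He] at this
      omega
  by_cases c2 : i + 1 < m ∧ m ≤ j + 1
  · have h0 := s.Gp he (i + 1) (by omega) (by omega)
    have h3 := h.hg (m - 1) (by omega)
    rw [Nat.sub_add_cancel (by omega), hGm] at h3
    constructor
    · rintro ⟨h1, h2⟩
      exfalso
      have := h2 (m - 2) (by omega) (by omega)
      rw [s.sH (m - 2) (by omega), if_neg (by omega), if_pos (by omega)] at this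
      rw [if_neg (by omega), if_pos (by omega)] at gi
      have hmm : m - 2 + 1 = m - 1 := by omega
      rw [hmm] at this
      omega
    · rintro ⟨h1, h2⟩
      exfalso
      have := h2 (m - 1) (by omega) (by omega)
      omega
  -- same zone
  have hH : ∀ k, i ≤ k → k < j → H' k - H (k + 1) = G' i - G (i + 1) := by
    intro k hk hk'
    rw [s.sH k (by omega), gi]
    split_ifs <;> omega
  have hG : G' j - G (j + 1) = G' i - G (i + 1) := by
    rw [gi, gj]
    split_ifs <;> omega
  constructor
  · rintro ⟨h1, h2⟩
    refine ⟨by omega, fun k hk1 hk2 => ?_⟩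
    have := h2 (k - 1) (by omega) (by omega)
    have h4 := hH (k - 1) (by omega) (by omega)
    rw [Nat.sub_add_cancel (by omega)] at h4
    omega
  · rintro ⟨h1, h2⟩
    refine ⟨by omega, fun k hk1 hk2 => ?_⟩
    have := h2 (k + 1) (by omega) (by omega)
    have := hH k (by omega) (by omega)
    omega

lemma rotB {q : ℕ} {G H G' H' : ℕ → ℤ} {e m : ℕ} (h : Hts q G H)
    (s : HStep q G H G' H' e m) (i : ℕ) (hi : i + 1 < q) :
    Blk G' H' i (q - 1) ↔ Blk G H 0 (i + 1) := by
  have gi := s.sG i (by omega)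
  have gi0 := h.gn (i + 1) (by omega)
  have elt := s.elt
  have sL := s.sL
  have g0 := h.g0
  rcases Nat.eq_zero_or_pos e with he | he
  · have hm := s.m0 he
    constructor
    · rintro ⟨h1, h2⟩
      exfalso
      have := h2 (q - 2) (by omega) (by omega)
      have hq : q - 2 + 1 = q - 1 := by omega
      rw [s.sH (q - 2) (by omega), if_neg (by omega), if_neg (by omega), hq, h.he] at this
      omega
    · rintro ⟨h1, h2⟩
      exfalso
      have := h2 0 (by omega) (by omega)
      have := s.He
      rw [he] at this
      omega
  obtain ⟨hm1, hme, hGm⟩ := s.m1 he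
  constructor
  · rintro ⟨h1, h2⟩
    by_cases c1 : i + 1 < m
    · exfalso
      have h3 := h.hg (m - 1) (by omega)
      rw [Nat.sub_add_cancel (by omega), hGm] at h3
      have := h2 (m - 2) (by omega) (by omega)
      rw [s.sH (m - 2) (by omega), if_neg (by omega), if_pos (by omega)] at this
      have hmm : m - 2 + 1 = m - 1 := by omega
      rw [hmm] at this
      omega
    by_cases c2 : i < e
    · rw [if_pos (by omega), if_pos (by omega)] at gi
      refine ⟨by omega, fun k _ hk2 => ?_⟩
      rw [g0]
      exact s.Hp k (by omega)
    · exfalso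
      rw [if_pos (by omega), if_neg (by omega)] at gi
      omega
  · rintro ⟨h1, h2⟩
    have c2 : i < e := by
      by_contra hc
      have := h2 e (by omega) (by omega)
      rw [s.He] at this
      omega
    have c1 : m ≤ i + 1 := by
      by_contra hc
      have := s.Gp he (i + 1) (by omega) (by omega)
      omega
    rw [if_pos (by omega), if_pos (by omega)] at gi
    refine ⟨by omega, fun k hk1 hk2 => ?_⟩
    rw [s.sH k (by omega), if_pos (by omega)]
    by_cases hk : k + 1 < e
    · rw [if_pos hk]
      have := s.Hp (k + 1) hk
      omega
    · rw [if_neg hk]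
      have := h.gn (k + 1) (by omega)
      have := h.gh (k + 1) (by omega)
      omega

lemma blk_open {q : ℕ} {G H : ℕ → ℤ} (h : Hts q G H) (i : ℕ) (hi : i < q) :
    H i = G i + 1 ↔ ∃ j, i < j ∧ j < q ∧ Blk G H i j := by
  constructor
  · intro hu
    have hiq : i + 1 < q := by
      by_contra hc
      have : i = q - 1 := by omega
      have h1 := h.he
      have h2 := h.gn i hi
      rw [← this] at h1
      omega
    have hex : ∃ j, i < j ∧ j < q ∧ G j ≤ G i := by
      refine ⟨q - 1, by omega, by omega, ?_⟩
      have := h.gh (q - 1) (by omega)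
      have := h.he
      have := h.gn i hi
      omega
    obtain ⟨h1, h2, h3⟩ := Nat.find_spec hex
    have hmin := fun k => Nat.find_min hex (m := k)
    generalize Nat.find hex = j at *
    have hH : ∀ k, i ≤ k → k < j → G i < H k := by
      intro k hk1 hk2
      rcases Nat.eq_or_lt_of_le hk1 with rfl | hk
      · omega
      · have h4 := hmin k hk2
        have := h.gh k (by omega)
        have : ¬ G k ≤ G i := fun h5 => h4 ⟨hk, by omega, h5⟩
        omega
    refine ⟨j, h1, h2, ?_, hH⟩
    have h5 := hH (j - 1) (by omega) (by omega)
    have h6 := h.hg (j - 1) (by omega)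
    rw [Nat.sub_add_cancel (by omega)] at h6
    omega
  · rintro ⟨j, h1, h2, h3, h4⟩
    have := h4 i le_rfl h1
    have := h.gh i hi
    omega

lemma blk_close {q : ℕ} {G H : ℕ → ℤ} (h : Hts q G H) (j : ℕ) (hj : j + 1 < q) :
    H j = G (j + 1) + 1 ↔ ∃ i, i < j + 1 ∧ Blk G H i (j + 1) := by
  constructor
  · intro hu
    have hex : ∃ d, d ≤ j ∧ G (j - d) ≤ G (j + 1) := by
      refine ⟨j, le_rfl, ?_⟩
      have := h.gn (j + 1) hj
      rw [Nat.sub_self, h.g0]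
      exact this
    obtain ⟨h2, h3⟩ := Nat.find_spec hex
    have hmin := fun k => Nat.find_min hex (m := k)
    generalize Nat.find hex = d at *
    have hG : ∀ k, j - d < k → k ≤ j → G (j + 1) < G k := by
      intro k hk1 hk2
      have h4 := hmin (j - k) (by omega)
      have h5 : j - (j - k) = k := by omega
      rw [h5] at h4
      have : ¬ G k ≤ G (j + 1) := fun h5 => h4 ⟨by omega, h5⟩
      omega
    have hH : ∀ k, j - d ≤ k → k ≤ j → G (j + 1) < H k := by
      intro k hk1 hk2
      rcases Nat.eq_or_lt_of_le hk2 with rfl | hk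
      · omega
      · have := hG (k + 1) (by omega) (by omega)
        have := h.hg k (by omega)
        omega
    have h7 := hH (j - d) le_rfl (by omega)
    have h8 := h.gh (j - d) (by omega)
    refine ⟨j - d, by omega, by omega, fun k hk1 hk2 => ?_⟩
    have := hH k hk1 (by omega)
    omega
  · rintro ⟨i, h1, h3, h4⟩
    have := h4 j (by omega) (by omega)
    have := h.hg j hj
    omega

lemma hts_eq {q : ℕ} {G H G' H' : ℕ → ℤ} (h : Hts q G H) (h' : Hts q G' H')
    (hB : ∀ i j, i < j → j < q → (Blk G' H' i j ↔ Blk G H i j)) (k : ℕ) (hk : k < q) :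
    G' k = G k ∧ H' k = H k := by
  have hO : ∀ i, i < q → (H' i = G' i + 1 ↔ H i = G i + 1) := by
    intro i hi
    rw [blk_open h i hi, blk_open h' i hi]
    refine exists_congr fun j => ?_
    refine and_congr_right fun h1 => and_congr_right fun h2 => hB i j h1 h2
  have hC : ∀ i, i + 1 < q → (H' i = G' (i + 1) + 1 ↔ H i = G (i + 1) + 1) := by
    intro i hi
    rw [blk_close h i hi, blk_close h' i hi]
    refine exists_congr fun j => ?_
    refine and_congr_right fun h1 => hB j (i + 1) h1 hi
  induction k with
  | zero =>
    have := hO 0 hk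
    have := h.g0
    have := h'.g0
    have := h.gh 0 hk
    have := h'.gh 0 hk
    omega
  | succ k ih =>
    have := ih (by omega)
    have := hO (k + 1) hk
    have := hC k hk
    have := h.gh (k + 1) hk
    have := h'.gh (k + 1) hk
    have := h.hg k hk
    have := h'.hg k hk
    omega

lemma hts_periodic {q : ℕ} {G H : ℕ → ℕ → ℤ} (h : ∀ t, Hts q (G t) (H t))
    (hs : ∀ t, ∃ e m, HStep q (G t) (H t) (G (t + 1)) (H (t + 1)) e m) (t k : ℕ) (hk : k < q) :
    G (t + q) k = G t k ∧ H (t + q) k = H t k := by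
  refine hts_eq (h t) (h (t + q)) ?_ k hk
  have RA : ∀ d t i j, i < j → j + d < q →
      (Blk (G (t + d)) (H (t + d)) i j ↔ Blk (G t) (H t) (i + d) (j + d)) := by
    intro d
    induction d with
    | zero => intros; rfl
    | succ d ih =>
      intro t i j hij hj
      obtain ⟨e, m, s⟩ := hs (t + d)
      rw [← add_assoc t d 1, rotA (h (t + d)) s i j hij (by omega), ih t (i + 1) (j + 1) (by omega) (by omega)]
      have e1 : i + 1 + d = i + (d + 1) := by omega
      have e2 : j + 1 + d = j + (d + 1) := by omega
      rw [e1, e2]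
  have RB : ∀ t i, i + 1 < q →
      (Blk (G (t + 1)) (H (t + 1)) i (q - 1) ↔ Blk (G t) (H t) 0 (i + 1)) := by
    intro t i hi
    obtain ⟨e, m, s⟩ := hs t
    exact rotB (h t) s i hi
  intro i j hij hj
  have s1 := RA (q - 1 - j) (t + j + 1) i j hij (by omega)
  have s2 := RB (t + j) (i + (q - 1 - j)) (by omega)
  have s3 := RA (j - i - 1) (t + i + 1) 0 (i + (q - 1 - j) + 1) (by omega) (by omega)
  have s4 := RB (t + i) (j - i - 1) (by omega)
  have s5 := RA i t 0 (j - i) (by omega) (by omega)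
  have a1 : t + j + 1 + (q - 1 - j) = t + q := by omega
  have a2 : j + (q - 1 - j) = q - 1 := by omega
  have a3 : t + i + 1 + (j - i - 1) = t + j := by omega
  have a4 : i + (q - 1 - j) + 1 + (j - i - 1) = q - 1 := by omega
  have a5 : j - i - 1 + 1 = j - i := by omega
  have a6 : j - i + i = j := by omega
  rw [a1, a2] at s1
  rw [a3, a4, zero_add] at s3
  rw [a5] at s4
  rw [a6, zero_add] at s5
  rw [s1, s2, s3, s4, s5]

/-! ### Part 4: two-row tableaux -/

/-- Number of entries `≤ k` in a row with entries `p 1, …, p a`. -/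
def rowCnt (a : ℕ) (p : ℕ → ℕ) (k : ℕ) : ℕ := ((Finset.Icc 1 a).filter (fun j => p j ≤ k)).card

lemma rowCnt_le (a : ℕ) (p : ℕ → ℕ) (k : ℕ) : rowCnt a p k ≤ a := by
  have := Finset.card_filter_le (Finset.Icc 1 a) (fun j => p j ≤ k)
  simpa [rowCnt] using this

lemma row_mono {a : ℕ} {p : ℕ → ℕ} (hp : ∀ k, k ≤ a → p k < p (k + 1)) (i j : ℕ) (hij : i ≤ j)
    (hj : j ≤ a + 1) : p i + (j - i) ≤ p j := by
  induction j with
  | zero =>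
    have : i = 0 := by omega
    subst this; simp
  | succ j ih =>
    rcases Nat.eq_or_lt_of_le hij with rfl | h
    · simp
    · have := ih (by omega) (by omega)
      have := hp j (by omega)
      omega

lemma le_rowCnt {a : ℕ} {p : ℕ → ℕ} (hp : ∀ k, k ≤ a → p k < p (k + 1)) (j k : ℕ) (h1 : 1 ≤ j)
    (h2 : j ≤ a) : j ≤ rowCnt a p k ↔ p j ≤ k := by
  constructor
  · intro h
    by_contra hc
    have : (Finset.Icc 1 a).filter (fun j => p j ≤ k) ⊆ Finset.Icc 1 (j - 1) := by
      intro i hi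
      simp only [Finset.mem_filter, Finset.mem_Icc] at hi ⊢
      by_contra hn
      have := row_mono hp j i (by omega) (by omega)
      omega
    have := Finset.card_le_card this
    simp only [Nat.card_Icc] at this
    unfold rowCnt at h
    omega
  · intro h
    have : Finset.Icc 1 j ⊆ (Finset.Icc 1 a).filter (fun j => p j ≤ k) := by
      intro i hi
      simp only [Finset.mem_filter, Finset.mem_Icc] at hi ⊢
      have := row_mono hp i j (by omega) (by omega)
      omega
    have := Finset.card_le_card this
    simp only [Nat.card_Icc] at this
    unfold rowCnt
    omega

lemma rowCnt_eq {a : ℕ} {p : ℕ → ℕ} (hp : ∀ k, k ≤ a → p k < p (k + 1)) (k n : ℕ)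
    (hn : n ≤ a) (h : ∀ j, 1 ≤ j → j ≤ a → (p j ≤ k ↔ j ≤ n)) : rowCnt a p k = n := by
  have hle := rowCnt_le a p k
  apply le_antisymm
  · by_contra hc
    have h1 := (le_rowCnt hp (rowCnt a p k) k (by omega) hle).1 le_rfl
    have := (h (rowCnt a p k) (by omega) hle).1 h1
    omega
  · rcases Nat.eq_zero_or_pos n with h0 | h0
    · omega
    · exact (le_rowCnt hp n k h0 hn).2 ((h n h0 hn).2 le_rfl)

lemma rowCnt_step {a : ℕ} {p : ℕ → ℕ} (hp : ∀ k, k ≤ a → p k < p (k + 1)) (k : ℕ) :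
    rowCnt a p k ≤ rowCnt a p (k + 1) ∧ rowCnt a p (k + 1) ≤ rowCnt a p k + 1 := by
  have hle := rowCnt_le a p k
  have hle' := rowCnt_le a p (k + 1)
  constructor
  · rcases Nat.eq_zero_or_pos (rowCnt a p k) with h0 | h0
    · omega
    · have h1 := (le_rowCnt hp (rowCnt a p k) k h0 hle).1 le_rfl
      exact (le_rowCnt hp (rowCnt a p k) (k + 1) h0 hle).2 (by omega)
  · by_contra hc
    have h1 := (le_rowCnt hp (rowCnt a p (k + 1)) (k + 1) (by omega) hle').1 le_rfl
    have h2 := row_mono hp (rowCnt a p (k + 1) - 1) (rowCnt a p (k + 1)) (by omega) (by omega)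
    have := (le_rowCnt hp (rowCnt a p (k + 1) - 1) k (by omega) (by omega)).2 (by omega)
    omega

/-- Two-row increasing tableaux, with sentinels. -/
structure TwoRow (a q : ℕ) (p c : ℕ → ℕ) : Prop where
  p0 : p 0 = 0
  c0 : c 0 = 1
  pe : p (a + 1) = q
  ce : c (a + 1) = q + 1
  pm : ∀ k, k ≤ a → p k < p (k + 1)
  cm : ∀ k, k ≤ a → c k < c (k + 1)
  pc : ∀ k, k ≤ a + 1 → p k < c k

/-- Promotion of two-row tableaux. -/
structure TwoStep (a : ℕ) (p c p' c' : ℕ → ℕ) : Prop where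
  sp : ∀ k, k < a → (p' k + 1 < p (k + 1) ∧ p' (k + 1) + 1 = p (k + 1)) ∨
    (p (k + 1) ≤ p' k + 1 ∧ p' (k + 1) + 1 = min (p (k + 1 + 1)) (c (k + 1)))
  sc : ∀ k, k < a → (c' k + 1 < c (k + 1) ∧ p' (k + 1) + 1 < c (k + 1) ∧
      c' (k + 1) + 1 = c (k + 1)) ∨
    ((c (k + 1) ≤ c' k + 1 ∨ c (k + 1) ≤ p' (k + 1) + 1) ∧ c' (k + 1) + 1 = c (k + 1 + 1))

/-- Explicit form of a promotion step. -/
structure JK (a : ℕ) (p c p' c' : ℕ → ℕ) (J K : ℕ) : Prop where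
  Ja : J ≤ a
  K1 : 1 ≤ K
  Ka : K ≤ a + 1
  pa : ∀ j, 1 ≤ j → j < J → p' j + 1 = p (j + 1)
  pb : 1 ≤ J → p' J + 1 = c J
  pd : ∀ j, J < j → j ≤ a → p' j + 1 = p j
  ca : ∀ j, 1 ≤ j → j < K → c' j + 1 = c j
  cb : ∀ j, K ≤ j → j ≤ a → c' j + 1 = c (j + 1)
  cs : (J = 0 ∧ K = a + 1 ∧ 1 < p 1) ∨ (1 ≤ J ∧ K ≤ J ∧ p 1 = 1)
  j1 : ∀ j, 1 ≤ j → j < J → p (j + 1) ≤ c j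
  j2 : 1 ≤ J → J < a → c J < p (J + 1)
  k1 : ∀ j, 1 ≤ j → j < K → K ≤ a → p (j + 1) < c j
  k2 : K < a → c K ≤ p (K + 1)

lemma exists_JK {a q : ℕ} (ha : 0 < a) {p c p' c' : ℕ → ℕ} (h : TwoRow a q p c)
    (h' : TwoRow a q p' c') (s : TwoStep a p c p' c') : ∃ J K, JK a p c p' c' J K := by
  have hp1 := h.pm 0 (by omega)
  have hc1 := h.cm 0 (by omega)
  rw [h.p0] at hp1
  rw [h.c0] at hc1
  simp only [zero_add] at hp1 hc1
  by_cases h1 : 1 < p 1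
  · have A : ∀ j, j < a → p' (j + 1) + 1 = p (j + 1) := by
      intro j
      induction j with
      | zero =>
        intro hj
        have := s.sp 0 hj
        have := h'.p0
        simp only [zero_add] at *
        omega
      | succ j ih =>
        intro hj
        have := ih (by omega)
        have := s.sp (j + 1) hj
        have := h.pm (j + 1) (by omega)
        omega
    have C : ∀ j, j < a → c' (j + 1) + 1 = c (j + 1) := by
      intro j
      induction j with
      | zero =>
        intro hj
        have := A 0 hj
        have := s.sc 0 hj
        have := h'.c0
        have := h.pc 1 (by omega)
        simp only [zero_add] at *
        omega
      | succ j ih =>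
        intro hj
        have := ih (by omega)
        have := A (j + 1) hj
        have := s.sc (j + 1) hj
        have := h.cm (j + 1) (by omega)
        have := h.pc (j + 1 + 1) (by omega)
        omega
    refine ⟨0, a + 1, by omega, by omega, by omega, by omega, by omega, ?_, ?_, by omega,
      by omega, by omega, by omega, by omega, by omega⟩
    · intro j hj hja
      have := A (j - 1) (by omega)
      rwa [Nat.sub_add_cancel (by omega)] at this
    · intro j hj hja
      have := C (j - 1) (by omega)
      rwa [Nat.sub_add_cancel (by omega)] at this
  · have hp : p 1 = 1 := by omega
    have exJ : ∃ j, 1 ≤ j ∧ (j = a ∨ c j < p (j + 1)) := ⟨a, ha, Or.inl rfl⟩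
    have exK : ∃ j, 1 ≤ j ∧ (j = a ∨ c j ≤ p (j + 1)) := ⟨a, ha, Or.inl rfl⟩
    obtain ⟨J1, J2⟩ := Nat.find_spec exJ
    have Jm := fun k => Nat.find_min exJ (m := k)
    have JA : Nat.find exJ ≤ a := Nat.find_min' exJ ⟨ha, Or.inl rfl⟩
    obtain ⟨K1, K2⟩ := Nat.find_spec exK
    have Km := fun k => Nat.find_min exK (m := k)
    have KJ : Nat.find exK ≤ Nat.find exJ :=
      Nat.find_min' exK ⟨J1, by rcases J2 with J2 | J2 <;> omega⟩
    generalize Nat.find exJ = J at *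
    generalize Nat.find exK = K at *
    have jj1 : ∀ j, 1 ≤ j → j < J → p (j + 1) ≤ c j := by
      intro j hj hj'
      have := Jm j hj'
      by_contra hc
      exact this ⟨hj, Or.inr (by omega)⟩
    have kk1 : ∀ j, 1 ≤ j → j < K → p (j + 1) < c j := by
      intro j hj hj'
      have := Km j hj'
      by_contra hc
      exact this ⟨hj, Or.inr (by omega)⟩
    have A : ∀ j, j < J → p' j + 1 = p (j + 1) := by
      intro j
      induction j with
      | zero => intro _; rw [h'.p0, zero_add, hp]
      | succ j ih =>
        intro hj
        have := ih (by omega)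
        have := s.sp j (by omega)
        have := jj1 (j + 1) (by omega) hj
        omega
    have hJ' : J - 1 + 1 = J := by omega
    have A2 : p' J + 1 = c J := by
      have e1 := A (J - 1) (by omega)
      have e2 := s.sp (J - 1) (by omega)
      rw [hJ'] at e1 e2
      have e3 := h.pe
      have e4 := h.cm J (by omega)
      have e5 := h.ce
      rcases J2 with J2 | J2
      · have e6 : p (J + 1) = q := by rw [J2]; exact e3
        have e7 : c (J + 1) = q + 1 := by rw [J2]; exact e5
        omega
      · omega
    have A3 : ∀ d, J + d < a → p' (J + d + 1) + 1 = p (J + d + 1) := by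
      intro d
      induction d with
      | zero =>
        intro hd
        have := s.sp J (by omega)
        simp only [add_zero]
        omega
      | succ d ih =>
        intro hd
        have := ih (by omega)
        have := s.sp (J + d + 1) (by omega)
        have := h.pm (J + d + 1) (by omega)
        simp only [← add_assoc]
        omega
    have C : ∀ j, j < K → c' j + (if j = 0 then 0 else 1) = c j := by
      intro j
      induction j with
      | zero => intro _; rw [h'.c0, h.c0]; simp
      | succ j ih =>
        intro hj
        have i1 := ih (by omega)
        have i2 := s.sc j (by omega)
        have i3 := kk1 (j + 1) (by omega) hj
        have i4 := A (j + 1) (by omega)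
        have i5 := h.cm j (by omega)
        have i6 := h.pm (j + 1) (by omega)
        rw [if_neg (by omega)]
        split_ifs at i1 with hj0
        · subst hj0
          have := h'.c0
          simp only [zero_add] at *
          have := h.pc 1 (by omega)
          omega
        · omega
    have hK' : K - 1 + 1 = K := by omega
    have C2 : c' K + 1 = c (K + 1) := by
      have i2 := s.sc (K - 1) (by omega)
      rw [hK'] at i2
      have i3 : c K ≤ p' K + 1 := by
        rcases Nat.eq_or_lt_of_le KJ with e | e
        · rw [e, A2]
        · rw [A K e]; omega
      omega
    have C3 : ∀ d, K + d ≤ a → c' (K + d) + 1 = c (K + d + 1) := by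
      intro d
      induction d with
      | zero => intro _; exact C2
      | succ d ih =>
        intro hd
        have := ih (by omega)
        have := s.sc (K + d) (by omega)
        simp only [← add_assoc]
        omega
    refine ⟨J, K, by omega, by omega, by omega, fun j _ hj => A j hj, fun _ => A2, ?_, ?_, ?_,
      by omega, jj1, by omega, fun j h1 h2 _ => kk1 j h1 h2, by omega⟩
    · intro j hj hja
      have := A3 (j - J - 1) (by omega)
      have e : J + (j - J - 1) + 1 = j := by omega
      rwa [e] at this
    · intro j hj hja
      have := C j hja
      rwa [if_neg (by omega)] at this
    · intro j hj hja
      have := C3 (j - K) (by omega)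
      have e : K + (j - K) = j := by omega
      rwa [e] at this

/-- Lower heights. -/
def rowG (a : ℕ) (p c : ℕ → ℕ) (i : ℕ) : ℤ := rowCnt a p i - rowCnt a c (i + 1)
/-- Upper heights. -/
def rowH (a : ℕ) (p c : ℕ → ℕ) (i : ℕ) : ℤ := rowCnt a p (i + 1) - rowCnt a c (i + 1)

lemma TwoRow.hts {a q : ℕ} (ha : 0 < a) {p c : ℕ → ℕ} (h : TwoRow a q p c) :
    Hts q (rowG a p c) (rowH a p c) where
  g0 := by
    have h1 : rowCnt a p 0 = 0 := rowCnt_eq h.pm 0 0 (by omega) (by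
      intro j h1 h2
      have := row_mono h.pm 0 j (by omega) (by omega)
      omega)
    have h2 : rowCnt a c 1 = 0 := rowCnt_eq h.cm 1 0 (by omega) (by
      intro j h1 h2
      have := row_mono h.cm 0 j (by omega) (by omega)
      have := h.c0
      omega)
    simp [rowG, h1, h2]
  gn := by
    intro i _
    have : rowCnt a c (i + 1) ≤ rowCnt a p i := by
      have hle := rowCnt_le a c (i + 1)
      rcases Nat.eq_zero_or_pos (rowCnt a c (i + 1)) with h0 | h0
      · omega
      · have h1 := (le_rowCnt h.cm (rowCnt a c (i + 1)) (i + 1) h0 hle).1 le_rfl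
        have := h.pc (rowCnt a c (i + 1)) (by omega)
        exact (le_rowCnt h.pm _ i h0 hle).2 (by omega)
    unfold rowG
    omega
  gh := by
    intro i _
    have := rowCnt_step h.pm i
    unfold rowG rowH
    omega
  hg := by
    intro i _
    have := rowCnt_step h.cm (i + 1)
    unfold rowG rowH
    omega
  he := by
    have := row_mono h.pm 0 (a + 1) (by omega) (by omega)
    have := h.pe
    have e : q - 1 + 1 = q := by omega
    have h1 : rowCnt a p q = a := rowCnt_eq h.pm q a le_rfl (by
      intro j h1 h2
      have := row_mono h.pm j (a + 1) (by omega) (by omega)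
      omega)
    have h2 : rowCnt a c q = a := rowCnt_eq h.cm q a le_rfl (by
      intro j h1 h2
      have := row_mono h.cm j (a + 1) (by omega) (by omega)
      have := h.ce
      omega)
    simp [rowH, e, h1, h2]

lemma two_step_hstep {a q : ℕ} (ha : 0 < a) {p c p' c' : ℕ → ℕ} (h : TwoRow a q p c)
    (h' : TwoRow a q p' c') (s : TwoStep a p c p' c') :
    ∃ e m, HStep q (rowG a p c) (rowH a p c) (rowG a p' c') (rowH a p' c') e m := by
  obtain ⟨J, K, s⟩ := exists_JK ha h h' s
  have H0 := h.hts ha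
  have hpe := h.pe
  have hce := h.ce
  have hp0 := h.p0
  have hc0 := h.c0
  have pm := row_mono h.pm
  have cm := row_mono h.cm
  have s1 := s.Ja
  have s2 := s.K1
  have s3 := s.Ka
  have s4 := s.cs
  have cJ1 : 1 ≤ c J := by have := cm 0 J (by omega) (by omega); omega
  have cJ : c J ≤ q := by have := cm J (a + 1) (by omega) (by omega); omega
  have cK1 : 2 ≤ c K := by have := cm 0 K (by omega) (by omega); omega
  have cKq : c K ≤ q + 1 := by have := cm K (a + 1) (by omega) (by omega); omega
  have gp := le_rowCnt h.pm
  have gc := le_rowCnt h.cm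
  have lp := rowCnt_le a p
  have lc := rowCnt_le a c
  -- the two counting formulas
  have FU : ∀ k, rowCnt a p' k + (if k + 1 < c J then 1 else 0) = rowCnt a p (k + 1) := by
    intro k
    have hpos : k + 1 < c J → 1 ≤ rowCnt a p (k + 1) := by
      intro hk
      have : 1 ≤ J := by
        by_contra hc
        have : J = 0 := by omega
        rw [this] at hk
        omega
      exact (gp 1 (k + 1) le_rfl (by omega)).2 (by omega)
    have hn : rowCnt a p' k = rowCnt a p (k + 1) - (if k + 1 < c J then 1 else 0) := by
      apply rowCnt_eq h'.pm
      · have := lp (k + 1); omega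
      intro j hj hja
      have g0 := gp j (k + 1) hj hja
      by_cases hk : k + 1 < c J
      · rw [if_pos hk]
        have hpos := hpos hk
        have g1 : j ≤ rowCnt a p (k + 1) - 1 ↔ j < a ∧ p (j + 1) ≤ k + 1 := by
          by_cases hja' : j < a
          · have := gp (j + 1) (k + 1) (by omega) (by omega)
            omega
          · have := lp (k + 1)
            omega
        rw [g1]
        rcases lt_trichotomy j J with hjJ | hjJ | hjJ
        · have := s.pa j hj hjJ
          omega
        · subst hjJ
          have := s.pb hj
          have := s.j2 hj
          omega
        · have := s.pd j hjJ hja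
          have e1 := pm j (j + 1) (by omega) (by omega)
          have e2 := pm (J + 1) j (by omega) (by omega)
          have J1 : 1 ≤ J := by
            by_contra hc
            have : J = 0 := by omega
            rw [this] at hk
            omega
          have := s.j2 J1 (by omega)
          omega
      · rw [if_neg hk, Nat.sub_zero, g0]
        rcases lt_trichotomy j J with hjJ | hjJ | hjJ
        · have := s.pa j hj hjJ
          have := s.j1 j hj hjJ
          have := cm j J (by omega) (by omega)
          have := pm j (j + 1) (by omega) (by omega)
          omega
        · subst hjJ
          have := s.pb hj
          have := h.pc j (by omega)
          omega
        · have := s.pd j hjJ hja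
          omega
    rw [hn]
    split_ifs with hk
    · have := hpos hk; omega
    · omega
  have FV : ∀ k, k < q → rowCnt a c' k + (if c K ≤ k + 1 then 1 else 0) = rowCnt a c (k + 1) := by
    intro k hkq
    have hKa : c K ≤ k + 1 → K ≤ a := by
      intro hk
      by_contra hc
      have : K = a + 1 := by omega
      rw [this] at hk
      omega
    have hpos : c K ≤ k + 1 → 1 ≤ rowCnt a c (k + 1) := by
      intro hk
      have := (gc K (k + 1) s2 (hKa hk)).2 hk
      omega
    have hn : rowCnt a c' k = rowCnt a c (k + 1) - (if c K ≤ k + 1 then 1 else 0) := by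
      apply rowCnt_eq h'.cm
      · have := lc (k + 1); omega
      intro j hj hja
      have g0 := gc j (k + 1) hj hja
      have g1 : j + 1 ≤ rowCnt a c (k + 1) ↔ c (j + 1) ≤ k + 1 := by
        by_cases hja' : j < a
        · exact gc (j + 1) (k + 1) (by omega) (by omega)
        · have := lc (k + 1)
          have e : j = a := by omega
          rw [e, hce]
          omega
      by_cases hjK : j < K
      · have := s.ca j hj hjK
        have := cm (j + 1) K (by omega) (by omega)
        split_ifs with hk <;> omega
      · have := s.cb j (by omega) hja
        have := cm K j (by omega) (by omega)
        have := cm j (j + 1) (by omega) (by omega)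
        split_ifs with hk <;> omega
    rw [hn]
    split_ifs with hk
    · have := hpos hk; omega
    · omega
  -- heights
  have hz : ∀ k, 1 ≤ J → k + 1 < c J → rowCnt a c (k + 1) < rowCnt a p (k + 1) := by
    intro k J1 hk
    have p1 : p 1 = 1 := by omega
    have hv : rowCnt a c (k + 1) < J := by
      by_contra hc
      have := (gc J (k + 1) J1 s1).1 (by omega)
      omega
    refine (gp (rowCnt a c (k + 1) + 1) (k + 1) (by omega) (by omega)).2 ?_
    rcases Nat.eq_zero_or_pos (rowCnt a c (k + 1)) with h0 | h0
    · rw [h0, zero_add, p1]; omega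
    · have := s.j1 _ h0 hv
      have := (gc (rowCnt a c (k + 1)) (k + 1) h0 (by omega)).1 le_rfl
      omega
  refine ⟨c J - 1, c K - 1, ?_⟩
  constructor
  · omega
  · -- He
    have e : c J - 1 + 1 = c J := by omega
    unfold rowH
    rw [e]
    have e1 : rowCnt a p (c J) = J := by
      apply rowCnt_eq h.pm _ _ s1
      intro j hj hja
      constructor
      · intro hle
        by_contra hc
        have q1 := pm (J + 1) j (by omega) (by omega)
        rcases s4 with s4 | s4
        · have hJ0 := s4.1
          have e6 : c J = c 0 := by rw [hJ0]
          have e7 : p (J + 1) = p 1 := by rw [hJ0]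
          omega
        · have := s.j2 s4.1 (by omega)
          omega
      · intro hle
        have := pm j J (by omega) (by omega)
        have := h.pc J (by omega)
        omega
    have e2 : rowCnt a c (c J) = J := by
      apply rowCnt_eq h.cm _ _ s1
      intro j hj hja
      constructor
      · intro hle
        by_contra hc
        have q1 := cm J j (by omega) (by omega)
        omega
      · intro hle
        have := cm j J (by omega) (by omega)
        omega
    rw [e1, e2]; simp
  · -- Hp
    intro k hk
    have J1 : 1 ≤ J := by
      by_contra hc
      have : J = 0 := by omega
      rw [this] at hk
      omega
    have := hz k J1 (by omega)
    unfold rowH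
    omega
  · -- m0
    intro he
    rcases s4 with s4 | s4
    · rw [s4.2.1, hce]; omega
    · have := cm 0 J (by omega) (by omega)
      omega
  · -- m1
    intro he
    have J1 : 1 ≤ J ∧ K ≤ J ∧ p 1 = 1 := by
      rcases s4 with s4 | s4
      · rw [s4.1] at he; omega
      · exact s4
    have := cm K J (by omega) (by omega)
    refine ⟨by omega, by omega, ?_⟩
    have e : c K - 1 + 1 = c K := by omega
    unfold rowG
    rw [e]
    have e1 : rowCnt a p (c K - 1) = K := by
      apply rowCnt_eq h.pm _ _ (by omega)
      intro j hj hja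
      constructor
      · intro hle
        by_contra hc
        have q1 := pm (K + 1) j (by omega) (by omega)
        have := s.k2 (by omega)
        omega
      · intro hle
        have := pm j K (by omega) (by omega)
        have := h.pc K (by omega)
        omega
    have e2 : rowCnt a c (c K) = K := by
      apply rowCnt_eq h.cm _ _ (by omega)
      intro j hj hja
      constructor
      · intro hle
        by_contra hc
        have q1 := cm K j (by omega) (by omega)
        omega
      · intro hle
        have := cm j K (by omega) (by omega)
        omega
    rw [e1, e2]; simp
  · -- Gp
    intro he k hk1 hk
    have J1 : 1 ≤ J ∧ K ≤ J ∧ p 1 = 1 := by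
      rcases s4 with s4 | s4
      · rw [s4.1] at he; omega
      · exact s4
    have hv : rowCnt a c (k + 1) < K := by
      by_contra hc
      have := (gc K (k + 1) s2 (by omega)).1 (by omega)
      omega
    have : rowCnt a c (k + 1) + 1 ≤ rowCnt a p k := by
      refine (gp (rowCnt a c (k + 1) + 1) k (by omega) (by omega)).2 ?_
      rcases Nat.eq_zero_or_pos (rowCnt a c (k + 1)) with h0 | h0
      · rw [h0, zero_add]; omega
      · have := s.k1 _ h0 hv (by omega)
        have := (gc (rowCnt a c (k + 1)) (k + 1) h0 (by omega)).1 le_rfl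
        omega
    unfold rowG
    omega
  · -- sG
    intro k hk
    have f1 := FU k
    have f2 := FV (k + 1) hk
    unfold rowG
    split_ifs at * <;> omega
  · -- sH
    intro k hk
    have f1 := FU (k + 1)
    have f2 := FV (k + 1) hk
    unfold rowH
    split_ifs at * <;> omega
  · -- sL
    have hq : 1 ≤ q := by omega
    have e : q - 1 + 1 = q := by omega
    have f1 := FU (q - 1)
    rw [e, if_neg (by omega)] at f1
    have h1 : rowCnt a p q = a := rowCnt_eq h.pm q a le_rfl (by
      intro j h1 h2
      have := pm j (a + 1) (by omega) (by omega)
      omega)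
    have h2 : rowCnt a c' q = a := rowCnt_eq h'.cm q a le_rfl (by
      intro j h1 h2
      have := row_mono h'.cm j (a + 1) (by omega) (by omega)
      have := h'.ce
      omega)
    unfold rowG
    rw [e, h2]
    omega

/-! ### Part 5: shear and periodicity -/

/-- The upper row of the sheared tableau. -/
def shP (a : ℕ) (A : ℕ → ℕ → ℕ) (t k : ℕ) : ℕ := k + A (t + k) (a + 1 - k)

/-- The lower row of the sheared tableau. -/
def shC (a : ℕ) (B : ℕ → ℕ → ℕ) (t k : ℕ) : ℕ := k + 1 + B (t + k) (a + 1 - k)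

section shear
variable {a b : ℕ} {A B : ℕ → ℕ → ℕ}

lemma sh_row (hv : ∀ t, RLVal a b (A t) (B t)) (hA : ∀ t, A (t + 1) = nxA a b (A t) (B t))
    (hB : ∀ t, B (t + 1) = nxB a b (A t) (B t)) (t : ℕ) :
    TwoRow a (a + b + 1) (shP a A t) (shC a B t) := by
  constructor
  · simp [shP, (hv t).e1 (a + 1) (by omega)]
  · simp [shC, (hv t).e2 (a + 1) (by omega)]
  · simp only [shP, Nat.sub_self, (hv _).z1]; omega
  · simp only [shC, Nat.sub_self, (hv _).z2]; omega
  · intro k hk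
    have h := nx_facts (hv (t + k)) (a - k)
    rw [← hA, ← hB] at h
    have e1 : a + 1 - k = a - k + 1 := by omega
    have e2 : a + 1 - (k + 1) = a - k := by omega
    simp only [shP, e1, e2, ← add_assoc]
    omega
  · intro k hk
    have h := nx_facts (hv (t + k)) (a - k)
    rw [← hA, ← hB] at h
    have e1 : a + 1 - k = a - k + 1 := by omega
    have e2 : a + 1 - (k + 1) = a - k := by omega
    simp only [shC, e1, e2, ← add_assoc]
    omega
  · intro k hk
    have := (hv (t + k)).le (a + 1 - k)
    simp only [shP, shC]
    omega

lemma sh_step (hA : ∀ t, A (t + 1) = nxA a b (A t) (B t))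
    (hB : ∀ t, B (t + 1) = nxB a b (A t) (B t)) (t : ℕ) :
    TwoStep a (shP a A t) (shC a B t) (shP a A (t + 1)) (shC a B (t + 1)) := by
  constructor
  · intro k hk
    obtain ⟨x, hx⟩ : ∃ x, a = x + 1 + k := ⟨a - k - 1, by omega⟩
    have h := nxA_succ a b (A (t + k + 1)) (B (t + k + 1)) x (by omega)
    rw [← hA] at h
    have e1 : a + 1 - k = x + 1 + 1 := by omega
    have e2 : a + 1 - (k + 1) = x + 1 := by omega
    have e3 : a + 1 - (k + 1 + 1) = x := by omega
    have e4 : t + 1 + k = t + k + 1 := by omega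
    have e5 : t + 1 + (k + 1) = t + k + 1 + 1 := by omega
    have e6 : t + (k + 1) = t + k + 1 := by omega
    have e7 : t + (k + 1 + 1) = t + k + 1 + 1 := by omega
    simp only [shP, shC, e1, e2, e3, e4, e5, e6, e7]
    omega
  · intro k hk
    obtain ⟨x, hx⟩ : ∃ x, a = x + 1 + k := ⟨a - k - 1, by omega⟩
    have h := nxB_succ a b (A (t + k + 1)) (B (t + k + 1)) x (by omega)
    rw [← hA, ← hB] at h
    have e1 : a + 1 - k = x + 1 + 1 := by omega
    have e2 : a + 1 - (k + 1) = x + 1 := by omega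
    have e3 : a + 1 - (k + 1 + 1) = x := by omega
    have e4 : t + 1 + k = t + k + 1 := by omega
    have e5 : t + 1 + (k + 1) = t + k + 1 + 1 := by omega
    have e6 : t + (k + 1) = t + k + 1 := by omega
    have e7 : t + (k + 1 + 1) = t + k + 1 + 1 := by omega
    simp only [shP, shC, e1, e2, e3, e4, e5, e6, e7]
    omega

end shear

lemma TwoRow.cnt0 {a q : ℕ} {p c : ℕ → ℕ} (h : TwoRow a q p c) : rowCnt a p 0 = 0 :=
  rowCnt_eq h.pm 0 0 (by omega) (by
    intro j h1 h2
    have := row_mono h.pm 0 j (by omega) (by omega)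
    omega)

lemma TwoRow.ext {a q : ℕ} {p c p' c' : ℕ → ℕ} (h : TwoRow a q p c) (h' : TwoRow a q p' c')
    (hG : ∀ k, k < q → rowG a p c k = rowG a p' c' k)
    (hH : ∀ k, k < q → rowH a p c k = rowH a p' c' k) (j : ℕ) (h1 : 1 ≤ j) (h2 : j ≤ a) :
    p j = p' j ∧ c j = c' j := by
  have U : ∀ k, k ≤ q → rowCnt a p k = rowCnt a p' k := by
    intro k
    induction k with
    | zero => intro _; rw [h.cnt0, h'.cnt0]
    | succ k ih =>
      intro hk
      have e1 := ih (by omega)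
      have e2 := hG k (by omega)
      have e3 := hH k (by omega)
      unfold rowG at e2
      unfold rowH at e3
      omega
  have V : ∀ k, k < q → rowCnt a c (k + 1) = rowCnt a c' (k + 1) := by
    intro k hk
    have e1 := U k (by omega)
    have e2 := hG k (by omega)
    unfold rowG at e2
    omega
  have b1 := row_mono h.pm j (a + 1) (by omega) (by omega)
  have b2 := row_mono h'.pm j (a + 1) (by omega) (by omega)
  have b3 := row_mono h.cm j (a + 1) (by omega) (by omega)
  have b4 := row_mono h'.cm j (a + 1) (by omega) (by omega)
  have b5 := row_mono h.cm 0 j (by omega) (by omega)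
  have b6 := row_mono h'.cm 0 j (by omega) (by omega)
  rw [h.pe] at b1
  rw [h'.pe] at b2
  rw [h.ce] at b3
  rw [h'.ce] at b4
  constructor
  · apply le_antisymm
    · rw [← le_rowCnt h.pm j _ h1 h2, U _ (by omega)]
      exact (le_rowCnt h'.pm j _ h1 h2).2 le_rfl
    · rw [← le_rowCnt h'.pm j _ h1 h2, ← U _ (by omega)]
      exact (le_rowCnt h.pm j _ h1 h2).2 le_rfl
  · apply le_antisymm
    · obtain ⟨m, hm⟩ : ∃ m, c' j = m + 1 := ⟨c' j - 1, by omega⟩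
      rw [← le_rowCnt h.cm j _ h1 h2, hm, V _ (by omega)]
      exact (le_rowCnt h'.cm j _ h1 h2).2 hm.le
    · obtain ⟨m, hm⟩ : ∃ m, c j = m + 1 := ⟨c j - 1, by omega⟩
      rw [← le_rowCnt h'.cm j _ h1 h2, hm, ← V _ (by omega)]
      exact (le_rowCnt h.cm j _ h1 h2).2 hm.le

lemma nx_inj {a b : ℕ} {l1 l2 m1 m2 : ℕ → ℕ} (h : RLVal a b l1 l2) (h' : RLVal a b m1 m2)
    (eA : nxA a b l1 l2 = nxA a b m1 m2) (eB : nxB a b l1 l2 = nxB a b m1 m2) :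
    ∀ d x, a < x + d → l1 x = m1 x ∧ l2 x = m2 x := by
  intro d
  induction d with
  | zero =>
    intro x hx
    rw [h.e1 x hx, h.e2 x hx, h'.e1 x hx, h'.e2 x hx]
    exact ⟨rfl, rfl⟩
  | succ d ih =>
    intro x hx
    cases x with
    | zero => rw [h.z1, h.z2, h'.z1, h'.z2]; exact ⟨rfl, rfl⟩
    | succ x =>
      by_cases hxa : x < a
      · have i := ih (x + 1 + 1) (by omega)
        have a1 := nxA_succ a b l1 l2 x hxa
        have a2 := nxB_succ a b l1 l2 x hxa
        have a3 := nxA_succ a b m1 m2 x hxa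
        have a4 := nxB_succ a b m1 m2 x hxa
        have f1 := nx_facts h x
        have f2 := nx_facts h' x
        have f3 := nx_facts h (x + 1)
        have f4 := nx_facts h' (x + 1)
        rw [← eA] at a3 a4
        rw [← eB] at a4
        rw [← eA, ← eB] at f2 f4
        have g1 := h.m1 (x + 1)
        have g2 := h.m2 (x + 1)
        have g3 := h'.m1 (x + 1)
        have g4 := h'.m2 (x + 1)
        have g5 := h.le (x + 1)
        have g6 := h'.le (x + 1)
        generalize nxA a b l1 l2 (x + 1) = A1 at *
        generalize nxA a b l1 l2 x = A0 at *
        generalize nxB a b l1 l2 (x + 1) = B1 at *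
        generalize nxB a b l1 l2 x = B0 at *
        have k2 : l2 (x + 1) = m2 (x + 1) := by clear a1 a3; omega
        refine ⟨?_, k2⟩
        clear a2 a4
        omega
      · exact ih _ (by omega)

lemma rl_periodic {a b : ℕ} {A B : ℕ → ℕ → ℕ} (ha : 0 < a) (hv : ∀ t, RLVal a b (A t) (B t))
    (hA : ∀ t, A (t + 1) = nxA a b (A t) (B t))
    (hB : ∀ t, B (t + 1) = nxB a b (A t) (B t)) :
    A (a + b + 1) = A 0 ∧ B (a + b + 1) = B 0 := by
  have P := hts_periodic (q := a + b + 1) (G := fun t => rowG a (shP a A t) (shC a B t))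
    (H := fun t => rowH a (shP a A t) (shC a B t)) (fun t => (sh_row hv hA hB t).hts ha)
    (fun t => two_step_hstep ha (sh_row hv hA hB t) (sh_row hv hA hB (t + 1)) (sh_step hA hB t))
  have Q : A (a + (a + b + 1)) = A a ∧ B (a + (a + b + 1)) = B a := by
    have R : ∀ x, A (a + (a + b + 1)) x = A a x ∧ B (a + (a + b + 1)) x = B a x := by
      intro x
      by_cases h0 : x = 0
      · subst h0
        rw [(hv _).z1, (hv _).z1, (hv _).z2, (hv _).z2]; exact ⟨rfl, rfl⟩
      by_cases h1 : a < x
      · rw [(hv _).e1 _ h1, (hv _).e1 _ h1, (hv _).e2 _ h1, (hv _).e2 _ h1]; exact ⟨rfl, rfl⟩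
      have := TwoRow.ext (sh_row hv hA hB (x - 1 + (a + b + 1))) (sh_row hv hA hB (x - 1))
        (fun k hk => (P (x - 1) k hk).1) (fun k hk => (P (x - 1) k hk).2) (a + 1 - x)
        (by omega) (by omega)
      unfold shP shC at this
      have e1 : a + 1 - (a + 1 - x) = x := by omega
      have e2 : x - 1 + (a + b + 1) + (a + 1 - x) = a + (a + b + 1) := by omega
      have e3 : x - 1 + (a + 1 - x) = a := by omega
      rw [e1, e2, e3] at this
      omega
    exact ⟨funext fun x => (R x).1, funext fun x => (R x).2⟩
  have S : ∀ d, d ≤ a → A (a - d + (a + b + 1)) = A (a - d) ∧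
      B (a - d + (a + b + 1)) = B (a - d) := by
    intro d
    induction d with
    | zero => intro _; exact Q
    | succ d ih =>
      intro hd
      have i := ih (by omega)
      have e1 : a - d = a - (d + 1) + 1 := by omega
      have e2 : a - (d + 1) + 1 + (a + b + 1) = a - (d + 1) + (a + b + 1) + 1 := by omega
      rw [e1, e2, hA, hB, hA (a - (d + 1)), hB (a - (d + 1))] at i
      have := nx_inj (hv _) (hv _) i.1 i.2 (a + 1)
      exact ⟨funext fun x => (this x (by omega)).1, funext fun x => (this x (by omega)).2⟩
  have := S a le_rfl
  simpa using this

/-- Iterated promotion of row lengths. -/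
def rlIter (a b : ℕ) (l1 l2 : ℕ → ℕ) : ℕ → (ℕ → ℕ) × (ℕ → ℕ)
  | 0 => (l1, l2)
  | t + 1 => (nxA a b (rlIter a b l1 l2 t).1 (rlIter a b l1 l2 t).2,
      nxB a b (rlIter a b l1 l2 t).1 (rlIter a b l1 l2 t).2)

lemma rlIter_val {a b : ℕ} {l1 l2 : ℕ → ℕ} (h : RLVal a b l1 l2) (t : ℕ) :
    RLVal a b (rlIter a b l1 l2 t).1 (rlIter a b l1 l2 t).2 := by
  induction t with
  | zero => exact h
  | succ t ih => exact nx_val ih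

lemma promo_iter {a b : ℕ} {l1 l2 : ℕ → ℕ} (h : RLVal a b l1 l2) (T : ℕ × ℕ → ℕ)
    (hT : ∀ x y, x < a → y < b → T (x, y) = rlTab l1 l2 x y) (t : ℕ) :
    (kPromo (rectCells a b) (a + b + 1))^[t] T = fun c => if c ∈ rectCells a b then
      rlTab (rlIter a b l1 l2 t).1 (rlIter a b l1 l2 t).2 c.1 c.2 else T c := by
  induction t with
  | zero =>
    funext c
    obtain ⟨x, y⟩ := c
    split_ifs with hc
    · simp only [rectCells, Finset.mem_product, Finset.mem_range] at hc
      exact hT x y hc.1 hc.2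
    · rfl
  | succ t ih =>
    rw [Function.iterate_succ_apply', ih, promo_rl (rlIter_val h t)]
    · funext c
      split_ifs
      · rfl
      · rfl
    · intro x y hx hy
      have : (x, y) ∈ rectCells a b := by
        simp only [rectCells, Finset.mem_product, Finset.mem_range]; exact ⟨hx, hy⟩
      simp only [this, if_true]

/-! ### Part 6: from tableaux to row lengths -/

lemma card_init {b : ℕ} {P : ℕ → Prop} [DecidablePred P] (hP : ∀ y, y + 1 < b → P (y + 1) → P y) (y : ℕ)
    (hy : y < b) : y < ((Finset.range b).filter P).card ↔ P y := by
  have mono : ∀ d y, y + d < b → P (y + d) → P y := by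
    intro d
    induction d with
    | zero => intro y _ h; exact h
    | succ d ih => intro y hy h; exact ih y (by omega) (hP (y + d) (by omega) h)
  constructor
  · intro h
    by_contra hc
    have : (Finset.range b).filter P ⊆ Finset.range y := by
      intro i hi
      simp only [Finset.mem_filter, Finset.mem_range] at hi ⊢
      by_contra hn
      exact hc (mono (i - y) y (by omega) (by rw [Nat.add_sub_cancel' (by omega)]; exact hi.2))
    have := Finset.card_le_card this
    rw [Finset.card_range] at this
    omega
  · intro h
    have : Finset.range (y + 1) ⊆ (Finset.range b).filter P := by
      intro i hi
      simp only [Finset.mem_filter, Finset.mem_range] at hi ⊢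
      exact ⟨by omega, mono (y - i) i (by omega)
        (by rw [Nat.add_sub_cancel' (by omega)]; exact h)⟩
    have := Finset.card_le_card this
    rw [Finset.card_range] at this
    omega

/-- Row lengths of a tableau. -/
noncomputable def rlOf (a b z : ℕ) (T : ℕ × ℕ → ℕ) : ℕ → ℕ
  | 0 => b
  | x + 1 => if a < x + 1 then 0 else
      ((Finset.range b).filter (fun y => T (x, y) < x + y + 1 + z)).card

lemma mem_rect {a b x y : ℕ} : (x, y) ∈ rectCells a b ↔ x < a ∧ y < b := by
  simp only [rectCells, Finset.mem_product, Finset.mem_range]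

section toRL
variable {a b : ℕ} {T : ℕ × ℕ → ℕ} (hT : IsIncTab (rectCells a b) (a + b + 1) T)
include hT

lemma inc_row (x y : ℕ) (hx : x < a) (hy : y + 1 < b) : T (x, y) < T (x, y + 1) :=
  hT.2.1 (x, y) (mem_rect.2 ⟨hx, by omega⟩) (x, y + 1) (mem_rect.2 ⟨hx, hy⟩) rfl (by simp)

lemma inc_col (x y : ℕ) (hx : x + 1 < a) (hy : y < b) : T (x, y) < T (x + 1, y) :=
  hT.2.2 (x, y) (mem_rect.2 ⟨by omega, hy⟩) (x + 1, y) (mem_rect.2 ⟨hx, hy⟩) rfl (by simp)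

lemma inc_lower (x y : ℕ) (hx : x < a) (hy : y < b) : x + y + 1 ≤ T (x, y) := by
  induction x with
  | zero =>
    induction y with
    | zero => exact (hT.1 (0, 0) (mem_rect.2 ⟨hx, hy⟩)).1
    | succ y ih =>
      have := ih (by omega)
      have := inc_row hT 0 y hx hy
      omega
  | succ x ih =>
    have := ih (by omega)
    have := inc_col hT x y hx hy
    omega

lemma inc_upper : ∀ d e x y : ℕ, x + d + 1 = a → y + e + 1 = b → T (x, y) ≤ x + y + 3 := by
  intro d
  induction d with
  | zero =>
    intro e
    induction e with
    | zero =>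
      intro x y hx hy
      have := (hT.1 (x, y) (mem_rect.2 ⟨by omega, by omega⟩)).2
      omega
    | succ e ih =>
      intro x y hx hy
      have := ih x (y + 1) hx (by omega)
      have := inc_row hT x y (by omega) (by omega)
      omega
  | succ d ih =>
    intro e x y hx hy
    have := ih e (x + 1) y (by omega) hy
    have := inc_col hT x y (by omega) (by omega)
    omega

lemma rlOf_lt (z x y : ℕ) (hx : x < a) (hy : y < b) :
    y < rlOf a b z T (x + 1) ↔ T (x, y) < x + y + 1 + z := by
  rw [rlOf, if_neg (by omega)]
  apply card_init (P := fun y => T (x, y) < x + y + 1 + z) _ y hy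
  intro y hy h
  have := inc_row hT x y hx hy
  omega

lemma rlOf_val : RLVal a b (rlOf a b 1 T) (rlOf a b 2 T) := by
  have mono : ∀ z x, rlOf a b z T (x + 1) ≤ rlOf a b z T x := by
    intro z x
    cases x with
    | zero =>
      simp only [rlOf]
      split_ifs
      · omega
      · simpa using Finset.card_filter_le (Finset.range b) (fun y => T (0, y) < 0 + y + 1 + z)
    | succ x =>
      rw [rlOf]
      split_ifs with h
      · omega
      · rw [rlOf, if_neg (by omega)]
        apply Finset.card_le_card
        intro y hy
        simp only [Finset.mem_filter, Finset.mem_range] at hy ⊢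
        have := inc_col hT x y (by omega) hy.1
        omega
  refine ⟨rfl, rfl, mono 1, mono 2, ?_, ?_, ?_⟩
  · intro x
    cases x with
    | zero => exact le_rfl
    | succ x =>
      rw [rlOf, rlOf]
      split_ifs with h
      · exact le_rfl
      · apply Finset.card_le_card
        intro y hy
        simp only [Finset.mem_filter, Finset.mem_range] at hy ⊢
        omega
  · intro x hx
    cases x with
    | zero => omega
    | succ x => rw [rlOf, if_pos hx]
  · intro x hx
    cases x with
    | zero => omega
    | succ x => rw [rlOf, if_pos hx]

lemma rlOf_tab (x y : ℕ) (hx : x < a) (hy : y < b) :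
    T (x, y) = rlTab (rlOf a b 1 T) (rlOf a b 2 T) x y := by
  have h1 := rlOf_lt hT 1 x y hx hy
  have h2 := rlOf_lt hT 2 x y hx hy
  have h3 := inc_lower hT x y hx hy
  have h4 := inc_upper hT (a - 1 - x) (b - 1 - y) x y (by omega) (by omega)
  have h5 := rlTab_spec (rlOf a b 1 T) (rlOf a b 2 T) x y
  omega

lemma promo_order (ha : 0 < a) : (kPromo (rectCells a b) (a + b + 1))^[a + b + 1] T = T := by
  have P := rl_periodic (A := fun t => (rlIter a b (rlOf a b 1 T) (rlOf a b 2 T) t).1)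
    (B := fun t => (rlIter a b (rlOf a b 1 T) (rlOf a b 2 T) t).2) ha
    (fun t => rlIter_val (rlOf_val hT) t) (fun _ => rfl) (fun _ => rfl)
  rw [promo_iter (rlOf_val hT) T (rlOf_tab hT)]
  funext c
  obtain ⟨x, y⟩ := c
  split_ifs with hc
  · rw [P.1, P.2]
    rw [mem_rect] at hc
    exact (rlOf_tab hT x y hc.1 hc.2).symm
  · rfl

end toRL

/-! ### Part 7: the lower bound -/

/-- Row lengths of the maximal tableau. -/
def l0 (b : ℕ) : ℕ → ℕ
  | 0 => b
  | _ + 1 => 0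

lemma l0_val (a b : ℕ) : RLVal a b (l0 b) (l0 b) := by
  refine ⟨rfl, rfl, ?_, ?_, fun _ => le_rfl, ?_, ?_⟩
  · intro x; simp [l0]
  · intro x; simp [l0]
  · intro x hx
    cases x with
    | zero => omega
    | succ x => rfl
  · intro x hx
    cases x with
    | zero => omega
    | succ x => rfl

lemma l0_one (a b : ℕ) : (∀ x, x < a → (rlIter a b (l0 b) (l0 b) 1).1 (x + 1) = 0) ∧
    (∀ x, x ≤ a → (rlIter a b (l0 b) (l0 b) 1).2 x = b) := by
  constructor
  · intro x hx
    have := nxA_succ a b (l0 b) (l0 b) x hx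
    simp only [l0] at this
    simp only [rlIter]
    omega
  · intro x
    induction x with
    | zero => intro _; exact (rlIter_val (l0_val a b) 1).z2
    | succ x ih =>
      intro hx
      have h1 := ih (by omega)
      have := nxB_succ a b (l0 b) (l0 b) x hx
      simp only [l0] at this
      simp only [rlIter] at *
      omega

lemma l0_two (a b : ℕ) : ∀ x, x ≤ a → (rlIter a b (l0 b) (l0 b) 2).1 x = b ∧
    (rlIter a b (l0 b) (l0 b) 2).2 x = b := by
  intro x
  induction x with
  | zero =>
    intro _
    exact ⟨(rlIter_val (l0_val a b) 2).z1, (rlIter_val (l0_val a b) 2).z2⟩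
  | succ x ih =>
    intro hx
    have h1 := ih (by omega)
    obtain ⟨f1, f2⟩ := l0_one a b
    have g0 := f1 x hx
    have g2 := f2 (x + 1) hx
    have s1 := nxA_succ a b (rlIter a b (l0 b) (l0 b) 1).1 (rlIter a b (l0 b) (l0 b) 1).2 x hx
    have s2 := nxB_succ a b (rlIter a b (l0 b) (l0 b) 1).1 (rlIter a b (l0 b) (l0 b) 1).2 x hx
    have e1 : (rlIter a b (l0 b) (l0 b) 2).1 = nxA a b (rlIter a b (l0 b) (l0 b) 1).1
      (rlIter a b (l0 b) (l0 b) 1).2 := rfl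
    have e2 : (rlIter a b (l0 b) (l0 b) 2).2 = nxB a b (rlIter a b (l0 b) (l0 b) 1).1
      (rlIter a b (l0 b) (l0 b) 1).2 := rfl
    rw [← e1] at s1 s2
    rw [← e2] at s2
    omega

lemma l0_bound (a b : ℕ) (s : ℕ) : ∀ x, x ≤ a →
    b ≤ (rlIter a b (l0 b) (l0 b) (s + 2)).2 x + (s - (a - x)) := by
  induction s with
  | zero => intro x hx; have := (l0_two a b x hx).2; simp only [zero_add]; omega
  | succ s ihs =>
    intro x
    induction x with
    | zero => intro _; have := (rlIter_val (l0_val a b) (s + 1 + 2)).z2; omega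
    | succ x ih =>
      intro hx
      have h1 := ih (by omega)
      have i1 := ihs (x + 1) hx
      have i2 := ihs (x + 1 + 1)
      have k1 := (rlIter_val (l0_val a b) (s + 2)).leb (x + 1)
      have s2 := nxB_succ a b (rlIter a b (l0 b) (l0 b) (s + 2)).1
        (rlIter a b (l0 b) (l0 b) (s + 2)).2 x hx
      have e2 : (rlIter a b (l0 b) (l0 b) (s + 1 + 2)).2 =
        nxB a b (rlIter a b (l0 b) (l0 b) (s + 2)).1 (rlIter a b (l0 b) (l0 b) (s + 2)).2 := rfl
      rw [← e2] at s2
      by_cases hxa : x + 1 + 1 ≤ a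
      · have := i2 hxa
        omega
      · omega

/-- The maximal tableau. -/
def maxTab (c : ℕ × ℕ) : ℕ := c.1 + c.2 + 3

lemma maxTab_inc (a b : ℕ) : IsIncTab (rectCells a b) (a + b + 1) maxTab := by
  refine ⟨?_, ?_, ?_⟩
  · rintro ⟨x, y⟩ hc
    rw [mem_rect] at hc
    simp only [maxTab]; omega
  · intro c _ d _ h1 h2
    simp only [maxTab]; omega
  · intro c _ d _ h1 h2
    simp only [maxTab]; omega

/-- Corollary 4.9: the order of K-promotion on `Inc^{a+b+1}(a×b)` is exactly
`a + b + 1`. -/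
theorem order_kpromotion_ab1 (a b : ℕ) (ha : 0 < a) (hb : 0 < b) :
    IsLeast {m : ℕ | 0 < m ∧
      ∀ T : ℕ × ℕ → ℕ, IsIncTab (rectCells a b) (a + b + 1) T →
        (kPromo (rectCells a b) (a + b + 1))^[m] T = T} (a + b + 1) := by

  constructor
  · exact ⟨by omega, fun T hT => promo_order hT ha⟩
  · rintro m ⟨hm, hT⟩
    by_contra hlt
    have h := hT maxTab (maxTab_inc a b)
    rw [promo_iter (l0_val a b) maxTab] at h
    · have h := congrFun h (0, 0)
      have hc : ((0, 0) : ℕ × ℕ) ∈ rectCells a b := mem_rect.2 ⟨ha, hb⟩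
      simp only [hc, if_true, maxTab] at h
      have hs := rlTab_spec (rlIter a b (l0 b) (l0 b) m).1 (rlIter a b (l0 b) (l0 b) m).2 0 0
      rw [h] at hs
      simp only [zero_add] at hs
      have h0 : (rlIter a b (l0 b) (l0 b) m).2 1 = 0 := by omega
      rcases Nat.lt_or_ge m 2 with h2 | h2
      · have hm1 : m = 1 := by omega
        rw [hm1, (l0_one a b).2 1 ha] at h0
        omega
      · have hB := l0_bound a b (m - 2) 1 ha
        rw [Nat.sub_add_cancel h2, h0] at hB
        omega
    · intro x y _ _
      simp [maxTab, rlTab, l0]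
end

section
/- Let a, b, c be positive integers such that a + b + c − 1 is prime and c > (2ab − 2)/3 − a − b + 2 (equivalently, 3(a + b + c) > 2ab + 4). Then for every order ideal I ∈ J(𝐚×𝐛×𝐜), the cardinality of the rowmotion orbit of I, i.e., the least m > 0 with Row^m(I) = I, is a multiple of a + b + c − 1. -/
/-- Rowmotion on order ideals (lower sets) of a poset `P`: `I` is sent to the
order ideal generated by the minimal elements of the complement of `I`. -/
def rowmo {P : Type*} [PartialOrder P] (I : Set P) : Set P :=
  {x | ∃ m, Minimal (fun y => y ∉ I) m ∧ x ≤ m}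

/-- Minimal elements of the complement (inside the box), in natural coordinates. -/
def CMn (a b c : ℕ) (S : ℕ → ℕ → ℕ → Prop) (x y z : ℕ) : Prop :=
  x < a ∧ y < b ∧ z < c ∧ ¬ S x y z ∧
    ∀ x' y' z', x' ≤ x → y' ≤ y → z' ≤ z → ¬ S x' y' z' → x' = x ∧ y' = y ∧ z' = z

/-- Maximal elements of an ideal, in natural coordinates. -/
def CMx (S : ℕ → ℕ → ℕ → Prop) (x y z : ℕ) : Prop :=
  S x y z ∧ ∀ x' y' z', x ≤ x' → y ≤ y' → z ≤ z' → S x' y' z' → x' = x ∧ y' = y ∧ z' = z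

/-- A bi-infinite rowmotion orbit in natural coordinates. -/
structure RowSys (a b c : ℕ) (S : ℤ → ℕ → ℕ → ℕ → Prop) : Prop where
  box : ∀ t x y z, S t x y z → x < a ∧ y < b ∧ z < c
  low : ∀ t x y z x' y' z', S t x y z → x' ≤ x → y' ≤ y → z' ≤ z → S t x' y' z'
  row : ∀ t x y z, CMn a b c (S t) x y z ↔ CMx (S (t + 1)) x y z

namespace RowSys

variable {a b c : ℕ} {S : ℤ → ℕ → ℕ → ℕ → Prop}

theorem mn_of (h : RowSys a b c S) {t : ℤ} {x y z : ℕ} (hx : x < a) (hy : y < b) (hz : z < c)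
    (hn : ¬ S t x y z) (h1 : 0 < x → S t (x - 1) y z) (h2 : 0 < y → S t x (y - 1) z)
    (h3 : 0 < z → S t x y (z - 1)) : CMn a b c (S t) x y z := by
  refine ⟨hx, hy, hz, hn, ?_⟩
  intro x' y' z' hx' hy' hz' hn'
  by_contra hne
  apply hn'
  rcases Nat.lt_or_ge x' x with hlt | hge
  · exact h.low _ _ _ _ _ _ _ (h1 (by omega)) (by omega) hy' hz'
  rcases Nat.lt_or_ge y' y with hlt | hge
  · exact h.low _ _ _ _ _ _ _ (h2 (by omega)) hx' (by omega) hz'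
  rcases Nat.lt_or_ge z' z with hlt | hge
  · exact h.low _ _ _ _ _ _ _ (h3 (by omega)) hx' hy' (by omega)
  omega

theorem mem_next (h : RowSys a b c S) {t : ℤ} {x y z : ℕ} (hm : CMn a b c (S t) x y z) :
    S (t + 1) x y z := ((h.row t x y z).1 hm).1

theorem not_next (h : RowSys a b c S) {t : ℤ} {x y z x' y' z' : ℕ}
    (hm : CMn a b c (S t) x y z) (hx : x ≤ x') (hy : y ≤ y') (hz : z ≤ z')
    (hne : x < x' ∨ y < y' ∨ z < z') : ¬ S (t + 1) x' y' z' := by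
  intro hs
  have := ((h.row t x y z).1 hm).2 x' y' z' hx hy hz hs
  omega

/-- Find a minimal element in a slice, bounded below in the second coordinate. -/
theorem find_min (T : ℕ → ℕ → Prop) {x y l : ℕ} (hT : ¬ T x y) (hl : l ≤ y) :
    ∃ x' y', x' ≤ x ∧ y' ≤ y ∧ l ≤ y' ∧ ¬ T x' y' ∧ (0 < x' → T (x' - 1) y') ∧
      (l < y' → T x' (y' - 1)) := by
  induction hn : x + y using Nat.strong_induction_on generalizing x y with
  | _ n ih =>
    by_cases h1 : 0 < x ∧ ¬ T (x - 1) y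
    · obtain ⟨x', y', g1, g2, g3⟩ := ih (x - 1 + y) (by omega) h1.2 hl rfl
      exact ⟨x', y', by omega, g2, g3⟩
    by_cases h2 : l < y ∧ ¬ T x (y - 1)
    · obtain ⟨x', y', g1, g2, g3⟩ := ih (x + (y - 1)) (by omega) h2.2 (by omega) rfl
      exact ⟨x', y', g1, by omega, g3⟩
    refine ⟨x, y, le_rfl, le_rfl, hl, hT, ?_, ?_⟩
    · intro h; by_contra h'; exact h1 ⟨h, h'⟩
    · intro h; by_contra h'; exact h2 ⟨h, h'⟩

theorem side (h : RowSys a b c S) {t : ℤ} {x y : ℕ} (hm : CMn a b c (S t) x y 0)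
    (hy : y + 1 < b) : ∃ x', CMn a b c (S (t + 1)) x' (y + 1) 0 := by
  have hn : ¬ S (t + 1) x (y + 1) 0 :=
    h.not_next hm le_rfl (by omega) le_rfl (by omega)
  obtain ⟨x', y', g1, g2, g3, g4, g5, g6⟩ :=
    find_min (fun x y => S (t + 1) x y 0) (l := y + 1) hn le_rfl
  have : y' = y + 1 := by omega
  subst this
  have hs := h.mem_next hm
  refine ⟨x', h.mn_of (by have := hm.1; omega) hy hm.2.2.1 g4 g5 ?_ (by omega)⟩
  intro _
  exact h.low _ _ _ _ _ _ _ hs g1 (by omega) le_rfl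

theorem up (h : RowSys a b c S) {t : ℤ} {x y z : ℕ} (hm : CMn a b c (S t) x y z)
    (hz : z + 1 < c) : ∃ x' y', CMn a b c (S (t + 1)) x' y' (z + 1) ∧ y' ≤ y := by
  have hn : ¬ S (t + 1) x y (z + 1) :=
    h.not_next hm le_rfl le_rfl (by omega) (by omega)
  obtain ⟨x', y', g1, g2, g3, g4, g5, g6⟩ :=
    find_min (fun x y => S (t + 1) x y (z + 1)) (l := 0) hn (Nat.zero_le _)
  have hs := h.mem_next hm
  refine ⟨x', y', h.mn_of (by have := hm.1; omega) (by have := hm.2.1; omega) hz g4 g5 g6 ?_, g2⟩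
  intro _
  exact h.low _ _ _ _ _ _ _ hs g1 g2 (by omega)

theorem up_right (h : RowSys a b c S) {t : ℤ} {s l x y z : ℕ}
    (hm' : CMn a b c (S t) s l (z + 1)) (hm : CMn a b c (S t) x y z) (hl : l < y) :
    ∃ x' y', CMn a b c (S (t + 1)) x' y' (z + 1) ∧ l < y' ∧ y' ≤ y := by
  have hn : ¬ S (t + 1) (min s x) y (z + 1) := by
    rcases le_total s x with hsx | hsx
    · rw [min_eq_left hsx]
      exact h.not_next hm' le_rfl (by omega) (by omega) (by omega)
    · rw [min_eq_right hsx]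
      exact h.not_next hm le_rfl le_rfl (by omega) (by omega)
  obtain ⟨x', y', g1, g2, g3, g4, g5, g6⟩ :=
    find_min (fun x y => S (t + 1) x y (z + 1)) (l := l + 1) hn (by omega)
  have hs := h.mem_next hm
  have hs' := h.mem_next hm'
  have e1 : x' ≤ s := by omega
  have e2 : x' ≤ x := by omega
  refine ⟨x', y', h.mn_of (by have := hm.1; omega) (by have := hm.2.1; omega) hm'.2.2.1 g4 g5
    ?_ ?_, by omega, g2⟩
  · intro _
    rcases Nat.lt_or_ge (l + 1) y' with hlt | hge
    · exact g6 hlt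
    · exact h.low _ _ _ _ _ _ _ hs' e1 (by omega) le_rfl
  · intro _
    exact h.low _ _ _ _ _ _ _ hs e2 g2 (by omega)

theorem build_seq (c : ℕ) (P : ℕ → ℕ × ℕ → Prop) (v0 : ℕ × ℕ) (h0 : P 0 v0)
    (hs : ∀ k, k + 1 < c → ∀ v, P k v → ∃ v', P (k + 1) v' ∧ v'.2 ≤ v.2) :
    ∃ f : ℕ → ℕ × ℕ, f 0 = v0 ∧ (∀ k, k < c → P k (f k)) ∧
      ∀ k, k + 1 < c → (f (k + 1)).2 ≤ (f k).2 := by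
  classical
  let f : ℕ → ℕ × ℕ := fun n => Nat.rec v0
    (fun k v => if h : ∃ v', P (k + 1) v' ∧ v'.2 ≤ v.2 then h.choose else v) n
  have fs : ∀ k, f (k + 1) =
      if h : ∃ v', P (k + 1) v' ∧ v'.2 ≤ (f k).2 then h.choose else f k := fun k => rfl
  have hP : ∀ k, k < c → P k (f k) := by
    intro k
    induction k with
    | zero => intro _; exact h0
    | succ k ih =>
      intro hk
      have hex := hs k hk _ (ih (by omega))
      rw [fs, dif_pos hex]
      exact hex.choose_spec.1
  refine ⟨f, rfl, hP, ?_⟩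
  intro k hk
  have hex := hs k hk _ (hP k (by omega))
  rw [fs, dif_pos hex]
  exact hex.choose_spec.2

/-- A vertical sequence of minimal elements, one at each level, at consecutive times. -/
def VSeq (a b c : ℕ) (S : ℤ → ℕ → ℕ → ℕ → Prop) (t : ℤ) (N m : ℕ) : Prop :=
  ∃ f : ℕ → ℕ × ℕ, (∀ k, k < c → CMn a b c (S (t + k)) (f k).1 (f k).2 k ∧ m ≤ (f k).2) ∧
    (∀ k, k + 1 < c → (f (k + 1)).2 ≤ (f k).2) ∧ (f 0).2 ≤ N

theorem vseq_zero (h : RowSys a b c S) {t : ℤ} {x y : ℕ} (hx : x < a) (hy : y < b) (hc : 0 < c)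
    (hn : ¬ S t x y 0) : VSeq a b c S t y 0 := by
  obtain ⟨x', y', g1, g2, g3, g4, g5, g6⟩ :=
    find_min (fun x y => S t x y 0) (l := 0) hn (Nat.zero_le _)
  have hm : CMn a b c (S t) x' y' 0 := h.mn_of (by omega) (by omega) hc g4 g5 g6 (by omega)
  obtain ⟨f, f0, f1, f2⟩ := build_seq c (fun k v => CMn a b c (S (t + k)) v.1 v.2 k) (x', y')
    (by simpa using hm) (by
      intro k hk v hv
      obtain ⟨x'', y'', e1, e2⟩ := h.up hv hk
      refine ⟨(x'', y''), ?_, e2⟩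
      push_cast
      rw [← add_assoc]
      exact e1)
  exact ⟨f, fun k hk => ⟨f1 k hk, Nat.zero_le _⟩, f2, by rw [f0]; exact g2⟩

theorem vseq_succ (h : RowSys a b c S) {t : ℤ} {N m : ℕ} (hc : 0 < c) (hN : N + 1 < b)
    (hv : VSeq a b c S t N m) : VSeq a b c S (t + 1) (N + 1) (m + 1) := by
  obtain ⟨f, f1, f2, f3⟩ := hv
  have h0 := (f1 0 hc).1
  simp only [Nat.cast_zero, add_zero] at h0
  obtain ⟨x0, hx0⟩ := h.side h0 (by omega)
  obtain ⟨g, g0, g1, g2⟩ := build_seq c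
    (fun k v => CMn a b c (S (t + 1 + k)) v.1 v.2 k ∧ (f k).2 < v.2) (x0, (f 0).2 + 1)
    (by
      refine ⟨?_, Nat.lt_succ_self _⟩
      simpa using hx0)
    (by
      rintro k hk v ⟨hv1, hv2⟩
      have hfk := (f1 (k + 1) hk).1
      have e : t + ((k + 1 : ℕ) : ℤ) = t + 1 + k := by push_cast; ring
      rw [e] at hfk
      obtain ⟨x'', y'', e1, e2, e3⟩ := h.up_right hfk hv1 (by have := f2 k hk; omega)
      refine ⟨(x'', y''), ⟨?_, e2⟩, e3⟩
      push_cast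
      rw [← add_assoc]
      exact e1)
  refine ⟨g, fun k hk => ⟨(g1 k hk).1, ?_⟩, g2, ?_⟩
  · have := (g1 k hk).2
    have := (f1 k hk).2
    omega
  · rw [g0]
    show (f 0).2 + 1 ≤ N + 1
    omega

theorem claimA (h : RowSys a b c S) (hc : 0 < c) (ha : 0 < a) {j : ℕ} (hj : j < b) {t : ℤ}
    (hn : ¬ S t (a - 1) (b - 1 - j) 0) : S (t + c + j) 0 j (c - 1) := by
  have key : ∀ i, i ≤ j → VSeq a b c S (t + i) (b - 1 - j + i) i := by
    intro i
    induction i with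
    | zero =>
      intro _
      simpa using h.vseq_zero (by omega) (by omega) hc hn
    | succ i ih =>
      intro hi
      have := h.vseq_succ hc (by omega) (ih (by omega))
      push_cast
      rw [← add_assoc, ← add_assoc]
      exact this
  obtain ⟨f, f1, _, _⟩ := key j le_rfl
  obtain ⟨e1, e2⟩ := f1 (c - 1) (by omega)
  have e3 := h.mem_next e1
  have e : t + (j : ℤ) + ((c - 1 : ℕ) : ℤ) + 1 = t + c + j := by
    have : ((c - 1 : ℕ) : ℤ) = (c : ℤ) - 1 := by omega
    rw [this]; ring
  rw [e] at e3
  exact h.low _ _ _ _ _ _ _ e3 (Nat.zero_le _) e2 le_rfl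

theorem swap (h : RowSys a b c S) : RowSys c b a (fun t x y z => S t z y x) := by
  constructor
  · intro t x y z hs
    have := h.box _ _ _ _ hs
    omega
  · intro t x y z x' y' z' hs hx hy hz
    exact h.low _ _ _ _ _ _ _ hs hz hy hx
  · intro t x y z
    have := h.row t z y x
    constructor
    · rintro ⟨h1, h2, h3, h4, h5⟩
      have g := this.1 ⟨h3, h2, h1, h4, fun x' y' z' e1 e2 e3 e4 => by
        have := h5 z' y' x' e3 e2 e1 e4; omega⟩
      exact ⟨g.1, fun x' y' z' e1 e2 e3 e4 => by
        have := g.2 z' y' x' e3 e2 e1 e4; omega⟩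
    · rintro ⟨h1, h2⟩
      obtain ⟨g1, g2, g3, g4, g5⟩ := this.2 ⟨h1, fun x' y' z' e1 e2 e3 e4 => by
        have := h2 z' y' x' e3 e2 e1 e4; omega⟩
      exact ⟨g3, g2, g1, g4, fun x' y' z' e1 e2 e3 e4 => by
        have := g5 z' y' x' e3 e2 e1 e4; omega⟩

theorem dual (h : RowSys a b c S) : RowSys a b c (fun t x y z => x < a ∧ y < b ∧ z < c ∧
    ¬ S (-t) (a - 1 - x) (b - 1 - y) (c - 1 - z)) := by
  constructor
  · rintro t x y z ⟨h1, h2, h3, -⟩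
    exact ⟨h1, h2, h3⟩
  · rintro t x y z x' y' z' ⟨h1, h2, h3, h4⟩ hx hy hz
    refine ⟨by omega, by omega, by omega, fun hs => h4 ?_⟩
    exact h.low _ _ _ _ _ _ _ hs (by omega) (by omega) (by omega)
  · intro t x y z
    have hr := h.row (-(t + 1)) (a - 1 - x) (b - 1 - y) (c - 1 - z)
    have e : -(t + 1) + 1 = -t := by ring
    rw [e] at hr
    constructor
    · rintro ⟨h1, h2, h3, h4, h5⟩
      have hS : S (-t) (a - 1 - x) (b - 1 - y) (c - 1 - z) := by
        by_contra hh; exact h4 ⟨h1, h2, h3, hh⟩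
      obtain ⟨-, -, -, g4, g5⟩ := hr.2 ⟨hS, fun x' y' z' e1 e2 e3 e4 => by
        have hb := h.box _ _ _ _ e4
        have := h5 (a - 1 - x') (b - 1 - y') (c - 1 - z') (by omega) (by omega) (by omega) (by
          rintro ⟨-, -, -, q⟩
          apply q
          have q1 : a - 1 - (a - 1 - x') = x' := by omega
          have q2 : b - 1 - (b - 1 - y') = y' := by omega
          have q3 : c - 1 - (c - 1 - z') = z' := by omega
          rw [q1, q2, q3]; exact e4)
        omega⟩
      refine ⟨⟨h1, h2, h3, g4⟩, ?_⟩
      rintro x' y' z' e1 e2 e3 ⟨k1, k2, k3, k4⟩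
      have := g5 _ _ _ (by omega) (by omega) (by omega) k4
      omega
    · rintro ⟨⟨h1, h2, h3, h4⟩, h5⟩
      have hM := hr.1 ⟨by omega, by omega, by omega, h4, fun x' y' z' e1 e2 e3 e4 => by
        have := h5 (a - 1 - x') (b - 1 - y') (c - 1 - z') (by omega) (by omega) (by omega) (by
          refine ⟨by omega, by omega, by omega, ?_⟩
          have q1 : a - 1 - (a - 1 - x') = x' := by omega
          have q2 : b - 1 - (b - 1 - y') = y' := by omega
          have q3 : c - 1 - (c - 1 - z') = z' := by omega
          rw [q1, q2, q3]; exact e4)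
        omega⟩
      refine ⟨h1, h2, h3, fun hh => hh.2.2.2 hM.1, ?_⟩
      intro x' y' z' e1 e2 e3 e4
      have hS : S (-t) (a - 1 - x') (b - 1 - y') (c - 1 - z') := by
        by_contra hh; exact e4 ⟨by omega, by omega, by omega, hh⟩
      have := hM.2 _ _ _ (by omega) (by omega) (by omega) hS
      omega

theorem claimA_dual (h : RowSys a b c S) (ha : 0 < a) (hc : 0 < c) {j : ℕ} (hj : j < b) {t : ℤ}
    (hs : S t 0 j (c - 1)) : ¬ S (t - c - j) (a - 1) (b - 1 - j) 0 := by
  have := h.dual.claimA hc ha hj (t := -t) (by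
    rintro ⟨-, -, -, q⟩
    apply q
    have q1 : a - 1 - (a - 1) = 0 := by omega
    have q2 : b - 1 - (b - 1 - j) = j := by omega
    have q3 : c - 1 - 0 = c - 1 := by omega
    rw [q1, q2, q3, neg_neg]; exact hs)
  have h4 := this.2.2.2
  have q0 : -(-t + (c : ℤ) + j) = t - c - j := by ring
  have q1 : a - 1 - 0 = a - 1 := by omega
  have q3 : c - 1 - (c - 1) = 0 := by omega
  rw [q0, q1, q3] at h4
  exact h4

theorem back (h : RowSys a b c S) (ha : 0 < a) (hc : 0 < c) {j : ℕ} (hj : j < b) {t : ℤ}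
    (hs : S t 0 j (c - 1)) : S (t - (a + b + c - 1)) 0 j (c - 1) := by
  have h1 := h.claimA_dual ha hc hj hs
  by_contra hn
  apply h1
  have q : b - 1 - (b - 1 - j) = j := by omega
  have := h.swap.claimA ha hc (j := b - 1 - j) (by omega) (t := t - (a + b + c - 1)) (by
    show ¬ S _ 0 _ (c - 1)
    rw [q]; exact hn)
  have e : t - ((a : ℤ) + b + c - 1) + a + ((b - 1 - j : ℕ) : ℤ) = t - c - j := by
    have : ((b - 1 - j : ℕ) : ℤ) = (b : ℤ) - 1 - j := by omega
    rw [this]; ring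
  rw [e] at this
  exact this

theorem back_mul (h : RowSys a b c S) (ha : 0 < a) (hc : 0 < c) {j : ℕ} (hj : j < b) {t : ℤ}
    (hs : S t 0 j (c - 1)) (n : ℕ) : S (t - n * (a + b + c - 1)) 0 j (c - 1) := by
  induction n with
  | zero => simpa using hs
  | succ n ih =>
    have := h.back ha hc hj ih
    convert this using 1
    push_cast; ring

theorem sometime_x (h : RowSys a b c S) (hb : 0 < b) (hc : 0 < c) (i : ℕ) (hi : i < a) :
    ∃ t, S t i 0 0 := by
  by_contra hne
  push Not at hne
  induction i with
  | zero => exact hne _ (h.mem_next (h.mn_of (t := 0) hi hb hc (hne 0) (by simp) (by simp) (by simp)))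
  | succ i ih =>
    apply ih (by omega)
    intro t ht
    exact hne _ (h.mem_next (h.mn_of (t := t) hi hb hc (hne t) (fun _ => ht) (by simp) (by simp)))

theorem sometime_y (h : RowSys a b c S) (ha : 0 < a) (hc : 0 < c) (i : ℕ) (hi : i < b) :
    ∃ t, S t 0 i 0 := by
  by_contra hne
  push Not at hne
  induction i with
  | zero => exact hne _ (h.mem_next (h.mn_of (t := 0) ha hi hc (hne 0) (by simp) (by simp) (by simp)))
  | succ i ih =>
    apply ih (by omega)
    intro t ht
    exact hne _ (h.mem_next (h.mn_of (t := t) ha hi hc (hne t) (by simp) (fun _ => ht) (by simp)))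

/-- No orbit has period coprime to `a + b + c - 1`. -/
theorem not_coprime (h : RowSys a b c S) (ha : 0 < a) (hb : 0 < b) (hc : 0 < c) (k : ℕ)
    (hk : 0 < k) (hper : ∀ (t m : ℤ), S (t + m * k) = S t)
    (hco : IsCoprime ((a : ℤ) + b + c - 1) k) : False := by
  have hconst : ∀ j, j < b → (∃ t, S t 0 j (c - 1)) → ∀ t, S t 0 j (c - 1) := by
    rintro j hj ⟨t, ht⟩ t'
    obtain ⟨u, v, huv⟩ := hco
    have hk' : (0 : ℤ) < k := by exact_mod_cast hk
    obtain ⟨n, hn⟩ : ∃ n : ℕ, (n : ℤ) = (t - t') * u % k :=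
      ⟨((t - t') * u % k).toNat, Int.toNat_of_nonneg (Int.emod_nonneg _ hk'.ne')⟩
    have h1 := h.back_mul ha hc hj ht n
    have h2 : t - n * ((a : ℤ) + b + c - 1) =
        t' + ((t - t') * v + (t - t') * u / k * ((a : ℤ) + b + c - 1)) * k := by
      have h3 := Int.emod_add_mul_ediv ((t - t') * u) k
      rw [← hn] at h3
      linear_combination (t' - t) * huv - ((a : ℤ) + b + c - 1) * h3
    rw [h2, hper] at h1
    exact h1
  have hall : ∀ j, j < b → ∀ t, S t 0 j (c - 1) := by
    intro j
    induction j with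
    | zero =>
      intro hj
      exact hconst 0 hj (h.swap.sometime_x hb ha (c - 1) (by omega))
    | succ s ih =>
      intro hj
      apply hconst _ hj
      by_contra hne
      push Not at hne
      have hdown : ∀ d, d < c → ∀ t, ¬ S t 0 (s + 1) (c - 1 - d) := by
        intro d
        induction d with
        | zero => intro _; simpa using hne
        | succ d ihd =>
          intro hd t ht
          apply ihd (by omega) (t + 1)
          apply h.mem_next
          refine h.mn_of ha hj (by omega) (ihd (by omega) t) (by simp) ?_ ?_
          · intro _
            exact h.low _ _ _ _ _ _ _ (ih (by omega) t) le_rfl (by omega) (by omega)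
          · intro _
            have : c - 1 - d - 1 = c - 1 - (d + 1) := by omega
            rw [this]; exact ht
      obtain ⟨t, ht⟩ := h.sometime_y ha hc (s + 1) hj
      have := hdown (c - 1) (by omega) t
      simp at this
      exact this ht
  obtain ⟨t, ht⟩ := h.sometime_x hb hc (a - 1) (by omega)
  have := h.claimA_dual ha hc (j := b - 1) (by omega) (hall (b - 1) (by omega) (t + c + (b - 1 : ℕ)))
  apply this
  have e : t + (c : ℤ) + ((b - 1 : ℕ) : ℤ) - c - ((b - 1 : ℕ) : ℤ) = t := by ring
  rw [e]
  simpa using ht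

end RowSys

theorem rowmo_lower {P : Type*} [PartialOrder P] (I : Set P) : IsLowerSet (rowmo I) := by
  rintro x y hyx ⟨m, hm, hx⟩
  exact ⟨m, hm, hyx.trans hx⟩

theorem minimal_iff_maximal_rowmo {P : Type*} [PartialOrder P] (I : Set P) (m : P) :
    Minimal (fun y => y ∉ I) m ↔ Maximal (fun y => y ∈ rowmo I) m := by
  constructor
  · intro hm
    refine ⟨⟨m, hm, le_rfl⟩, ?_⟩
    rintro y ⟨m', hm', hy⟩ hmy
    exact hy.trans (hm'.2 hm.1 (hmy.trans hy))
  · rintro ⟨⟨m', hm', h1⟩, h2⟩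
    have := h2 ⟨m', hm', le_rfl⟩ h1
    rwa [le_antisymm h1 this]

theorem rowSys_of_orbit {a b c : ℕ} (J : ℤ → Set (Fin a × Fin b × Fin c))
    (hlow : ∀ t, IsLowerSet (J t)) (hrow : ∀ t, J (t + 1) = rowmo (J t)) :
    RowSys a b c (fun t x y z => ∃ (hx : x < a) (hy : y < b) (hz : z < c),
      ((⟨x, hx⟩, ⟨y, hy⟩, ⟨z, hz⟩) : Fin a × Fin b × Fin c) ∈ J t) := by
  constructor
  · rintro t x y z ⟨hx, hy, hz, -⟩
    exact ⟨hx, hy, hz⟩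
  · rintro t x y z x' y' z' ⟨hx, hy, hz, hs⟩ h1 h2 h3
    refine ⟨by omega, by omega, by omega, hlow t ?_ hs⟩
    exact ⟨h1, h2, h3⟩
  · intro t x y z
    constructor
    · rintro ⟨hx, hy, hz, h4, h5⟩
      have hm : Minimal (fun y => y ∉ J t)
          ((⟨x, hx⟩, ⟨y, hy⟩, ⟨z, hz⟩) : Fin a × Fin b × Fin c) := by
        refine ⟨fun hh => h4 ⟨hx, hy, hz, hh⟩, ?_⟩
        rintro ⟨⟨x', hx'⟩, ⟨y', hy'⟩, ⟨z', hz'⟩⟩ hn ⟨l1, l2, l3⟩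
        obtain ⟨e1, e2, e3⟩ := h5 x' y' z' l1 l2 l3 (fun ⟨_, _, _, q⟩ => hn q)
        subst e1; subst e2; subst e3
        exact le_rfl
      rw [minimal_iff_maximal_rowmo, ← hrow] at hm
      refine ⟨⟨hx, hy, hz, hm.1⟩, ?_⟩
      rintro x' y' z' e1 e2 e3 ⟨hx', hy', hz', hs⟩
      have hle := hm.2 hs ⟨e1, e2, e3⟩
      have l1 : x' ≤ x := hle.1
      have l2 : y' ≤ y := hle.2.1
      have l3 : z' ≤ z := hle.2.2
      omega
    · rintro ⟨⟨hx, hy, hz, h4⟩, h5⟩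
      have hm : Maximal (fun y => y ∈ J (t + 1))
          ((⟨x, hx⟩, ⟨y, hy⟩, ⟨z, hz⟩) : Fin a × Fin b × Fin c) := by
        refine ⟨h4, ?_⟩
        rintro ⟨⟨x', hx'⟩, ⟨y', hy'⟩, ⟨z', hz'⟩⟩ hn ⟨l1, l2, l3⟩
        obtain ⟨e1, e2, e3⟩ := h5 x' y' z' l1 l2 l3 ⟨_, _, _, hn⟩
        subst e1; subst e2; subst e3
        exact le_rfl
      rw [hrow, ← minimal_iff_maximal_rowmo] at hm
      refine ⟨hx, hy, hz, fun ⟨_, _, _, q⟩ => hm.1 q, ?_⟩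
      intro x' y' z' e1 e2 e3 hn
      have hle := hm.2 (y := (⟨x', by omega⟩, ⟨y', by omega⟩, ⟨z', by omega⟩))
        (fun q => hn ⟨_, _, _, q⟩) ⟨e1, e2, e3⟩
      have l1 : x ≤ x' := hle.1
      have l2 : y ≤ y' := hle.2.1
      have l3 : z ≤ z' := hle.2.2
      omega

/-- Theorem 4.10: if `a + b + c - 1` is prime and `c > (2ab - 2)/3 - a - b + 2`
(equivalently `3(a + b + c) > 2ab + 4`), then the cardinality of every
rowmotion orbit on `J(𝐚 × 𝐛 × 𝐜)` (the minimal period of every order ideal) is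
a multiple of `a + b + c - 1`. -/
theorem strengthened_cameron_fonderflaass (a b c : ℕ)
    (ha : 0 < a) (hb : 0 < b) (hc : 0 < c)
    (hp : Nat.Prime (a + b + c - 1))
    (hbound : 3 * (a + b + c) > 2 * a * b + 4) :
    ∀ I : Set (Fin a × Fin b × Fin c), IsLowerSet I →
      (a + b + c - 1) ∣ Function.minimalPeriod rowmo I := by
  intro I hI
  by_contra hnd
  have hk : 0 < Function.minimalPeriod rowmo I := by
    rcases Nat.eq_zero_or_pos (Function.minimalPeriod rowmo I) with h0 | h0
    · rw [h0] at hnd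
      exact absurd (dvd_zero _) hnd
    · exact h0
  set k := Function.minimalPeriod rowmo I with hkdef
  have hk' : (0 : ℤ) < k := by exact_mod_cast hk
  have hit : ∀ n : ℕ, IsLowerSet (rowmo^[n] I) := by
    intro n
    cases n with
    | zero => exact hI
    | succ n =>
      rw [Function.iterate_succ_apply']
      exact rowmo_lower _
  have hrow : ∀ t : ℤ, rowmo^[((t + 1) % k).toNat] I = rowmo (rowmo^[(t % k).toNat] I) := by
    intro t
    rw [← Function.iterate_succ_apply' rowmo,
      ← Function.iterate_mod_minimalPeriod_eq (n := (t % k).toNat.succ), ← hkdef]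
    congr 2
    have h1 : ((t % k).toNat : ℤ) = t % k := Int.toNat_of_nonneg (Int.emod_nonneg _ hk'.ne')
    have h2 : (((t + 1) % k).toNat : ℤ) = (t + 1) % k :=
      Int.toNat_of_nonneg (Int.emod_nonneg _ hk'.ne')
    zify
    rw [h2, h1, Int.emod_add_emod]
  have hsys := rowSys_of_orbit (fun t : ℤ => rowmo^[(t % k).toNat] I) (fun t => hit _) hrow
  refine hsys.not_coprime ha hb hc k hk ?_ ?_
  · intro t m
    simp only [Int.add_mul_emod_self_right]
  · have h1 : Nat.Coprime (a + b + c - 1) k := (Nat.Prime.coprime_iff_not_dvd hp).2 hnd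
    have h2 := Nat.isCoprime_iff_coprime.2 h1
    have e : ((a + b + c - 1 : ℕ) : ℤ) = (a : ℤ) + b + c - 1 := by omega
    rw [e] at h2
    exact h2
end
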